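/- arXiv:2401.07987 — 3 statements merged into one kernel-verified Lean document; each statement's English description precedes it below -/
import Mathlib

section
/- Let R be a commutative noetherian ring, let a be an ideal of R, and let G be a Gorenstein injective R-module. Then the local cohomology modules H^i_a(G) vanish for all i > 0. -/
open CategoryTheory

universe u

/-- The `a`-torsion submodule `Γ_a(M) = {x ∈ M | a^n x = 0 for some n}`. -/
def torsionGamma {R : Type u} [CommRing R] (a : Ideal R) (M : Type u)
    [AddCommGroup M] [Module R M] : Submodule R M :=
  ⨆ n : ℕ, Submodule.torsionBySet R M ((a ^ n : Ideal R) : Set R)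

/-- Data witnessing that `G` is Gorenstein injective: a ℤ-indexed exact complex of
injective modules, remaining exact after `Hom_R(E', -)` for every injective `E'`,
with `G ≅ ker(E_0 → E_{-1})`. -/
structure GorensteinInjData (R : Type u) [CommRing R] (G : Type u)
    [AddCommGroup G] [Module R G] where
  E : ℤ → Type u
  [acg : ∀ i, AddCommGroup (E i)]
  [mod : ∀ i, Module R (E i)]
  d : ∀ i : ℤ, E (i + 1) →ₗ[R] E i
  inj : ∀ i, Module.Injective R (E i)
  exact : ∀ i : ℤ, LinearMap.range (d (i + 1)) = LinearMap.ker (d i)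
  homExact : ∀ (E' : Type u) [AddCommGroup E'] [Module R E'], Module.Injective R E' →
      ∀ (i : ℤ) (g : E' →ₗ[R] E (i + 1)),
        (d i).comp g = 0 ↔ ∃ f : E' →ₗ[R] E (i + 1 + 1), (d (i + 1)).comp f = g
  equiv : G ≃ₗ[R] LinearMap.ker (d (-1))

/-- An `R`-module `G` is Gorenstein injective. -/
def IsGorensteinInjective (R : Type u) [CommRing R] (G : Type u)
    [AddCommGroup G] [Module R G] : Prop :=
  Nonempty (GorensteinInjData R G)

/-- Data witnessing that `M` is Gorenstein flat. -/
structure GorensteinFlatData (R : Type u) [CommRing R] (M : Type u)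
    [AddCommGroup M] [Module R M] where
  F : ℤ → Type u
  [acg : ∀ i, AddCommGroup (F i)]
  [mod : ∀ i, Module R (F i)]
  d : ∀ i : ℤ, F (i + 1) →ₗ[R] F i
  flat : ∀ i, Module.Flat R (F i)
  exact : ∀ i : ℤ, LinearMap.range (d (i + 1)) = LinearMap.ker (d i)
  tensorExact : ∀ (E' : Type u) [AddCommGroup E'] [Module R E'], Module.Injective R E' →
      ∀ i : ℤ, LinearMap.range (LinearMap.lTensor E' (d (i + 1)))
        = LinearMap.ker (LinearMap.lTensor E' (d i))
  equiv : M ≃ₗ[R] LinearMap.ker (d (-1))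

/-- An `R`-module `M` is Gorenstein flat. -/
def IsGorensteinFlat (R : Type u) [CommRing R] (M : Type u)
    [AddCommGroup M] [Module R M] : Prop :=
  Nonempty (GorensteinFlatData R M)

/-- `E` is an injective hull of `M`: `E` is injective and admits an injective
linear map from `M` with essential image. -/
def IsInjectiveHull (R : Type u) [CommRing R] (M : Type u) [AddCommGroup M] [Module R M]
    (E : Type u) [AddCommGroup E] [Module R E] : Prop :=
  Module.Injective R E ∧ ∃ f : M →ₗ[R] E, Function.Injective f ∧
    ∀ N : Submodule R E, N ≠ ⊥ → N ⊓ LinearMap.range f ≠ ⊥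

/-- `D` is a dualizing module for `R`: finitely generated, of finite injective dimension,
the homothety map `R → Hom_R(D,D)` is bijective, and `Ext^i_R(D,D) = 0` for `i ≥ 1`. -/
def IsDualizingModule (R : Type u) [CommRing R] (D : Type u)
    [AddCommGroup D] [Module R D] : Prop :=
  Module.Finite R D ∧
  (∃ n : ℕ, ∀ (M : Type u) (_ : AddCommGroup M) (_ : Module R M), ∀ i : ℕ, n < i →
      Limits.IsZero (((Ext R (ModuleCat.{u} R) i).obj
        (Opposite.op (ModuleCat.of R M))).obj (ModuleCat.of R D))) ∧
  Function.Bijective (fun r : R => (r • (LinearMap.id : D →ₗ[R] D))) ∧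
  (∀ i : ℕ, 0 < i →
    Limits.IsZero (((Ext R (ModuleCat.{u} R) i).obj
      (Opposite.op (ModuleCat.of R D))).obj (ModuleCat.of R D)))

/-- The height of a prime ideal, as the `Order.height` of the corresponding
point of the prime spectrum. -/
noncomputable def idealHeight {R : Type u} [CommRing R] (p : Ideal R) (hp : p.IsPrime) : ℕ∞ :=
  Order.height (⟨p, hp⟩ : PrimeSpectrum R)

theorem GIaux_extend {R : Type u} [CommRing R] {A B E : Type u}
    [AddCommGroup A] [AddCommGroup B] [AddCommGroup E] [Module R A] [Module R B] [Module R E]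
    (hE : Module.Injective R E) (f : A →ₗ[R] B) (c : A →ₗ[R] E)
    (h : LinearMap.ker f ≤ LinearMap.ker c) : ∃ b : B →ₗ[R] E, b.comp f = c := by
  have hinj : Function.Injective ((LinearMap.ker f).liftQ f le_rfl) := by
    rw [← LinearMap.ker_eq_bot]
    exact Submodule.ker_liftQ_eq_bot _ _ _ le_rfl
  obtain ⟨b, hb⟩ := hE.out _ hinj ((LinearMap.ker f).liftQ c h)
  refine ⟨b, LinearMap.ext fun a => ?_⟩
  simpa using hb ((LinearMap.ker f).mkQ a)

/-- elements killed by a power of `x`. -/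
def GIaux_tors {R : Type u} [CommRing R] (x : R) (M : Type u)
    [AddCommGroup M] [Module R M] : Submodule R M where
  carrier := {m | ∃ n : ℕ, x ^ n • m = 0}
  zero_mem' := ⟨0, by simp⟩
  add_mem' := by
    rintro a b ⟨n, hn⟩ ⟨m, hm⟩
    refine ⟨n + m, ?_⟩
    rw [smul_add, pow_add, mul_smul, mul_smul, hm, smul_comm, hn]; simp
  smul_mem' := by
    rintro r a ⟨n, hn⟩
    exact ⟨n, by rw [smul_comm, hn, smul_zero]⟩

theorem GIaux_inj {R : Type u} [CommRing R] [IsNoetherianRing R] (x : R) (E : Type u)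
    [AddCommGroup E] [Module R E] (hE : Module.Injective R E) :
    Module.Injective R (GIaux_tors x E) := by
  rw [← Module.Baer.iff_injective]
  intro I g
  -- uniform exponent
  have h1 : ∃ n : ℕ, ∀ i, x ^ n • g i = 0 := by
    let f : ℕ →o Submodule R I :=
      ⟨fun n => LinearMap.ker (x ^ n • g), by
        intro n m hnm i hi
        obtain ⟨k, rfl⟩ := Nat.exists_eq_add_of_le hnm
        simp only [LinearMap.mem_ker, LinearMap.smul_apply] at hi ⊢
        rw [add_comm, pow_add, mul_smul, hi, smul_zero]⟩
    obtain ⟨n, hn⟩ := monotone_stabilizes_iff_noetherian.mpr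
      (inferInstance : IsNoetherian R I) f
    refine ⟨n, fun i => ?_⟩
    obtain ⟨k, hk⟩ := (g i).2
    have h2 : i ∈ f (n + k) := by
      change (x ^ (n + k) • g) i = 0
      apply Subtype.ext
      simp [pow_add, mul_smul, hk]
    rw [← hn (n + k) (by omega)] at h2
    exact h2
  obtain ⟨n, hn⟩ := h1
  obtain ⟨k, hk⟩ := Ideal.exists_pow_inf_eq_pow_smul (Ideal.span {x}) (M := R) I
  have h3 := hk (n + k) (by omega)
  simp only [Nat.add_sub_cancel] at h3
  let f : I →ₗ[R] R ⧸ Ideal.span {x ^ (n + k)} := (Submodule.mkQ _).comp I.subtype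
  obtain ⟨b, hb⟩ := GIaux_extend hE f ((Submodule.subtype _).comp g) (by
    intro i hi
    have hi' : (i : R) ∈ Ideal.span {x ^ (n + k)} := by
      exact (Submodule.Quotient.mk_eq_zero _).1 hi
    have h4 : (i : R) ∈ (Ideal.span {x} ^ (n + k) • ⊤ ⊓ I : Submodule R R) := by
      refine ⟨?_, i.2⟩
      rw [Ideal.span_singleton_pow]
      simpa using hi'
    rw [h3, Ideal.span_singleton_pow] at h4
    rw [Submodule.ideal_span_singleton_smul] at h4
    obtain ⟨j, hj, hji⟩ := h4
    have h5 : i = x ^ n • (⟨j, hj.2⟩ : I) := Subtype.ext hji.symm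
    rw [h5]
    simp only [LinearMap.mem_ker, LinearMap.comp_apply, map_smul]
    rw [← map_smul, hn, map_zero])
  refine ⟨LinearMap.codRestrict _ (b.comp (Submodule.mkQ _)) ?_, ?_⟩
  · intro r
    refine ⟨n + k, ?_⟩
    rw [LinearMap.comp_apply, ← map_smul, ← map_smul]
    have : (Ideal.span {x ^ (n + k)}).mkQ (x ^ (n + k) • r) = 0 := by
      rw [Submodule.mkQ_apply, Submodule.Quotient.mk_eq_zero]
      exact Ideal.mul_mem_right _ _ (Ideal.mem_span_singleton_self _)
    rw [this, map_zero]
  · intro r hr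
    apply Subtype.ext
    exact LinearMap.congr_fun hb ⟨r, hr⟩

theorem GIaux_split {R : Type u} [CommRing R] [IsNoetherianRing R] (x : R) (E : Type u)
    [AddCommGroup E] [Module R E] (hE : Module.Injective R E) (n : ℕ) (e : E) :
    ∃ (e' : E) (m : ℕ), x ^ m • (e - x ^ n • e') = 0 := by
  let f : ℕ →o Submodule R R :=
    ⟨fun n => LinearMap.ker (LinearMap.mulLeft R (x ^ n)), by
      intro n m hnm i hi
      obtain ⟨k, rfl⟩ := Nat.exists_eq_add_of_le hnm
      simp only [LinearMap.mem_ker, LinearMap.mulLeft_apply] at hi ⊢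
      rw [add_comm, pow_add, mul_assoc, hi, mul_zero]⟩
  obtain ⟨m, hm⟩ := monotone_stabilizes_iff_noetherian.mpr
    (inferInstance : IsNoetherian R R) f
  obtain ⟨b, hb⟩ := GIaux_extend hE (LinearMap.mulLeft R (x ^ (m + n)))
    (LinearMap.toSpanSingleton R E (x ^ m • e)) (by
      intro r hr
      have : r ∈ f (m + n) := hr
      rw [← hm (m + n) (by omega)] at this
      have h2 : x ^ m * r = 0 := this
      simp only [LinearMap.mem_ker, LinearMap.toSpanSingleton_apply]
      rw [← mul_smul, mul_comm, h2, zero_smul])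
  refine ⟨b 1, m, ?_⟩
  have := LinearMap.congr_fun hb 1
  simp only [LinearMap.comp_apply, LinearMap.mulLeft_apply, LinearMap.toSpanSingleton_apply,
    one_smul, mul_one] at this
  rw [smul_sub, ← this, ← mul_smul, ← pow_add, ← map_smul, smul_eq_mul, mul_one, sub_self]

theorem GIaux_exact {R : Type u} [CommRing R] [IsNoetherianRing R] (l : List R) :
    ∀ (E : ℤ → Type u) [∀ i, AddCommGroup (E i)] [∀ i, Module R (E i)]
    (d : ∀ i : ℤ, E (i + 1) →ₗ[R] E i) (_ : ∀ i, Module.Injective R (E i))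
    (_ : ∀ i : ℤ, LinearMap.range (d (i + 1)) = LinearMap.ker (d i))
    (i : ℤ) (z : E (i + 1)) (_ : d i z = 0) (_ : ∀ x ∈ l, ∃ n : ℕ, x ^ n • z = 0),
    ∃ y : E (i + 1 + 1), d (i + 1) y = z ∧ ∀ x ∈ l, ∃ n : ℕ, x ^ n • y = 0 := by
  induction l with
  | nil =>
    intro E _ _ d _ hex i z hz _
    have : z ∈ LinearMap.ker (d i) := hz
    rw [← hex] at this
    obtain ⟨y, hy⟩ := this
    exact ⟨y, hy, by simp⟩
  | cons x l ih =>
    intro E _ _ d hinj hex i z hz hl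
    let d' : ∀ i : ℤ, GIaux_tors x (E (i + 1)) →ₗ[R] GIaux_tors x (E i) := fun i =>
      (d i).restrict (fun e ⟨n, hn⟩ => ⟨n, by rw [← map_smul, hn, map_zero]⟩)
    have hd' : ∀ i e, ((d' i e : GIaux_tors x (E i)) : E i) = d i e := fun i e => rfl
    have hdd : ∀ i e, d i (d (i + 1) e) = 0 := fun i e => by
      have : d (i + 1) e ∈ LinearMap.ker (d i) := by rw [← hex]; exact ⟨e, rfl⟩
      exact this
    have hlift : ∀ i e, d i e = 0 → ∃ y, d (i + 1) y = e := fun i e he => by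
      have : e ∈ LinearMap.ker (d i) := he
      rw [← hex] at this
      exact this
    obtain ⟨y, hy, hyl⟩ := ih (fun i => GIaux_tors x (E i)) d' (fun i => GIaux_inj x _ (hinj i))
      (by
        intro i
        apply le_antisymm
        · rintro _ ⟨e, rfl⟩
          apply Subtype.ext
          exact hdd i e
        · rintro ⟨z, n, hn⟩ hz
          have hz' : d i z = 0 := congrArg Subtype.val hz
          obtain ⟨y, hy⟩ := hlift i z hz'
          obtain ⟨w, hw⟩ := hlift (i + 1) (x ^ n • y) (by rw [map_smul, hy, hn])
          obtain ⟨w', m, hm⟩ := GIaux_split x _ (hinj _) n w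
          refine ⟨⟨y - d _ w', m + n, ?_⟩, ?_⟩
          · rw [pow_add, mul_smul, smul_sub, ← hw, ← map_smul, ← map_sub, ← map_smul, hm, map_zero]
          · apply Subtype.ext
            change d _ (y - d _ w') = z
            rw [map_sub, hdd, hy, sub_zero])
      i ⟨z, hl x (by simp)⟩ (Subtype.ext hz) (fun r hr => by
        obtain ⟨n, hn⟩ := hl r (by simp [hr])
        exact ⟨n, Subtype.ext hn⟩)
    refine ⟨y, congrArg Subtype.val hy, ?_⟩
    intro r hr
    rcases List.mem_cons.1 hr with rfl | hr
    · exact y.2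
    · obtain ⟨n, hn⟩ := hyl r hr
      exact ⟨n, congrArg Subtype.val hn⟩

theorem GIaux_exact_ideal {R : Type u} [CommRing R] [IsNoetherianRing R] (a : Ideal R)
    (E : ℤ → Type u) [∀ i, AddCommGroup (E i)] [∀ i, Module R (E i)]
    (d : ∀ i : ℤ, E (i + 1) →ₗ[R] E i) (hinj : ∀ i, Module.Injective R (E i))
    (hex : ∀ i : ℤ, LinearMap.range (d (i + 1)) = LinearMap.ker (d i))
    (i : ℤ) (z : E (i + 1)) (hz : d i z = 0) (n : ℕ) (hn : ∀ r ∈ a ^ n, r • z = 0) :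
    ∃ y : E (i + 1 + 1), d (i + 1) y = z ∧ ∃ m, n ≤ m ∧ ∀ r ∈ a ^ m, r • y = 0 := by
  obtain ⟨s, hs⟩ := IsNoetherian.noetherian a
  obtain ⟨y, hy, hy2⟩ := GIaux_exact s.toList E d hinj hex i z hz (fun x hx =>
    ⟨n, hn _ (Ideal.pow_mem_pow (hs ▸ Ideal.subset_span (by simpa using hx)) n)⟩)
  refine ⟨y, hy, ?_⟩
  have h1 : a ≤ Ideal.radical (LinearMap.ker (LinearMap.toSpanSingleton R _ y)) := by
    rw [← hs]
    change Ideal.span _ ≤ _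
    rw [Ideal.span_le]
    intro x hx
    obtain ⟨k, hk⟩ := hy2 x (by simpa using hx)
    exact ⟨k, by simpa using hk⟩
  obtain ⟨k, hk⟩ := Ideal.exists_pow_le_of_le_radical_of_fg h1 (IsNoetherian.noetherian _)
  refine ⟨n + k, by omega, fun r hr => ?_⟩
  simpa using hk (Ideal.pow_le_pow_right (by omega) hr)

theorem GIaux_core {R : Type u} [CommRing R]
    (E : ℤ → Type u) [∀ i, AddCommGroup (E i)] [∀ i, Module R (E i)]
    (d : ∀ i : ℤ, E (i + 1) →ₗ[R] E i) (hinj : ∀ i, Module.Injective R (E i))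
    (hex : ∀ i : ℤ, LinearMap.range (d (i + 1)) = LinearMap.ker (d i))
    (P : ℕ → Type u) [∀ i, AddCommGroup (P i)] [∀ i, Module R (P i)]
    (dP : ∀ i, P (i + 1) →ₗ[R] P i)
    (hP : ∀ i, LinearMap.range (dP (i + 1)) = LinearMap.ker (dP i))
    (X : Type u) [AddCommGroup X] [Module R X] (ε : P 0 →ₗ[R] X)
    (hε : Function.Surjective ε) (hP0 : LinearMap.range (dP 0) = LinearMap.ker ε) (i : ℕ) :
    ∀ (j : ℤ) (c : P (i + 1) →ₗ[R] E (j + 1)), (d j).comp c = 0 → c.comp (dP (i + 1)) = 0 →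
    ∃ (k : ℤ) (z : X →ₗ[R] E (k + 1)), (d k).comp z = 0 ∧
    ∀ (Q : ℕ → Type u) [∀ i, AddCommGroup (Q i)] [∀ i, Module R (Q i)]
      (dQ : ∀ i, Q (i + 1) →ₗ[R] Q i) (_ : ∀ i, Module.Projective R (Q i))
      (_ : ∀ i, (dQ i).comp (dQ (i + 1)) = 0)
      (X' : Type u) [AddCommGroup X'] [Module R X'] (ε' : Q 0 →ₗ[R] X')
      (_ : ε'.comp (dQ 0) = 0)
      (φ : ∀ i, Q i →ₗ[R] P i) (_ : ∀ i, (φ i).comp (dQ i) = (dP i).comp (φ (i + 1)))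
      (θ : X' →ₗ[R] X) (_ : θ.comp ε' = ε.comp (φ 0)),
      (∃ y : X' →ₗ[R] E (k + 1 + 1), (d (k + 1)).comp y = z.comp θ) →
      ∃ b : Q i →ₗ[R] E (j + 1), (d j).comp b = 0 ∧ b.comp (dQ i) = c.comp (φ (i + 1)) := by
  have hdd : ∀ i, (d i).comp (d (i + 1)) = 0 := fun i => by
    ext e
    have : d (i + 1) e ∈ LinearMap.ker (d i) := by rw [← hex]; exact ⟨e, rfl⟩
    exact this
  induction i with
  | zero =>
    intro j c hc hcP
    obtain ⟨k, rfl⟩ : ∃ k, j = k + 1 := ⟨j - 1, by ring⟩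
    obtain ⟨b, hb⟩ := GIaux_extend (hinj _) (dP 0) c (by
      rw [← hP]; rintro _ ⟨p, rfl⟩; exact LinearMap.congr_fun hcP p)
    obtain ⟨z, hz⟩ := GIaux_extend (hinj _) ε ((d (k + 1)).comp b) (by
      rw [← hP0]; rintro _ ⟨p, rfl⟩
      have h1 := LinearMap.congr_fun hb p
      have h2 := LinearMap.congr_fun hc p
      simp only [LinearMap.comp_apply] at h1 h2
      simp [h1, h2])
    refine ⟨k, z, ?_, ?_⟩
    · ext x
      obtain ⟨p, rfl⟩ := hε x
      have h1 := LinearMap.congr_fun hz p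
      have h2 := LinearMap.congr_fun (hdd k) (b p)
      simp only [LinearMap.comp_apply] at h1 h2
      simp [h1, h2]
    · intro Q _ _ dQ hQ hQQ X' _ _ ε' hε' φ hφ θ hθ ⟨y, hy⟩
      refine ⟨b.comp (φ 0) - y.comp ε', ?_, ?_⟩
      · rw [LinearMap.comp_sub, ← LinearMap.comp_assoc, ← LinearMap.comp_assoc, hy, ← hz,
          LinearMap.comp_assoc, LinearMap.comp_assoc, hθ, sub_self]
      · rw [LinearMap.sub_comp, LinearMap.comp_assoc, LinearMap.comp_assoc, hφ, hε',
          ← LinearMap.comp_assoc, hb, LinearMap.comp_zero, sub_zero]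
  | succ i ih =>
    intro j c hc hcP
    obtain ⟨k, rfl⟩ : ∃ k, j = k + 1 := ⟨j - 1, by ring⟩
    obtain ⟨b, hb⟩ := GIaux_extend (hinj _) (dP (i + 1)) c (by
      rw [← hP]; rintro _ ⟨p, rfl⟩; exact LinearMap.congr_fun hcP p)
    obtain ⟨k', z, hz, H⟩ := ih k ((d (k + 1)).comp b)
      (by rw [← LinearMap.comp_assoc, hdd, LinearMap.zero_comp])
      (by rw [LinearMap.comp_assoc, hb, hc])
    refine ⟨k', z, hz, ?_⟩
    intro Q _ _ dQ hQ hQQ X' _ _ ε' hε' φ hφ θ hθ hy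
    obtain ⟨e, he, heQ⟩ := H Q dQ hQ hQQ X' ε' hε' φ hφ θ hθ hy
    obtain ⟨e', he'⟩ := Module.projective_lifting_property
      (LinearMap.rangeRestrict (d (k + 1)))
      (LinearMap.codRestrict (LinearMap.range (d (k + 1))) e (by
        intro q; rw [hex]; exact LinearMap.congr_fun he q))
      (LinearMap.surjective_rangeRestrict _)
    have he2 : (d (k + 1)).comp e' = e := by
      ext q
      exact congrArg Subtype.val (LinearMap.congr_fun he' q)
    refine ⟨b.comp (φ (i + 1)) - e'.comp (dQ i), ?_, ?_⟩
    · rw [LinearMap.comp_sub, ← LinearMap.comp_assoc, ← LinearMap.comp_assoc, he2, heQ, sub_self]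
    · rw [LinearMap.sub_comp, LinearMap.comp_assoc, LinearMap.comp_assoc, hφ, hQQ,
          ← LinearMap.comp_assoc, hb, LinearMap.comp_zero, sub_zero]

open Limits Opposite in
/-- The map on `Ext` kills a class as soon as cocycles become coboundaries. -/
theorem GIaux_ext {R : Type u} [CommRing R] (i : ℕ) (X G : ModuleCat.{u} R)
    (P : ProjectiveResolution X)
    (x : ((Ext R (ModuleCat.{u} R) (i + 1)).obj (op X)).obj G) :
    ∃ c : P.complex.X (i + 1) ⟶ G, P.complex.d (i + 2) (i + 1) ≫ c = 0 ∧
      ∀ (X' : ModuleCat.{u} R) (θ : X' ⟶ X) (Q : ProjectiveResolution X')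
        (φ : Q.complex ⟶ P.complex)
        (_ : φ ≫ P.π = Q.π ≫ (ChainComplex.single₀ _).map θ)
        (b : Q.complex.X i ⟶ G), φ.f (i + 1) ≫ c = Q.complex.d (i + 1) i ≫ b →
        ((Ext R (ModuleCat.{u} R) (i + 1)).map θ.op).app G x = 0 := by
  let F := ((linearYoneda R (ModuleCat.{u} R)).obj G).rightOp
  let KP := (F.mapHomologicalComplex (ComplexShape.down ℕ)).obj P.complex
  let isoP : (F.leftDerived (i + 1)).obj X ≅ KP.homology (i + 1) :=
    P.isoLeftDerivedObj F (i + 1)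
  let f₁ : (KP.opcycles (i + 1)).unop ⟶ ((F.leftDerived (i + 1)).obj X).unop :=
    (isoP.hom ≫ KP.homologyι (i + 1)).unop
  have hf₁ : Function.Surjective f₁ := by
    rw [← ModuleCat.epi_iff_surjective]
    have : Mono (isoP.hom ≫ KP.homologyι (i + 1)) := mono_comp _ _
    infer_instance
  obtain ⟨u, hu⟩ := hf₁ x
  let c : P.complex.X (i + 1) ⟶ G := (KP.pOpcycles (i + 1)).unop u
  refine ⟨c, ?_, ?_⟩
  · have h := KP.d_pOpcycles (i + 2) (i + 1)
    have h2 := congrArg (fun k => k.unop u) h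
    exact h2
  · intro X' θ Q φ hφ b hb
    let KQ := (F.mapHomologicalComplex (ComplexShape.down ℕ)).obj Q.complex
    let ψ : KQ ⟶ KP := (F.mapHomologicalComplex (ComplexShape.down ℕ)).map φ
    let isoQ : (F.leftDerived (i + 1)).obj X' ≅ KQ.homology (i + 1) :=
      Q.isoLeftDerivedObj F (i + 1)
    have hmap : (F.leftDerived (i + 1)).map θ =
      isoQ.hom ≫ HomologicalComplex.homologyMap ψ (i + 1) ≫ isoP.inv :=
        F.leftDerived_map_eq (i + 1) θ φ hφ
    have h1 : ((F.leftDerived (i + 1)).map θ) ≫ isoP.hom ≫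
        KP.homologyι (i + 1) = isoQ.hom ≫ KQ.homologyι (i + 1) ≫
          HomologicalComplex.opcyclesMap ψ (i + 1) := by
      rw [hmap]
      simp only [Category.assoc, Iso.inv_hom_id_assoc]
      rw [HomologicalComplex.homologyι_naturality ψ (i + 1)]
    have h2 := congrArg (fun k => k.unop u) h1
    have h3 : (HomologicalComplex.opcyclesMap ψ (i + 1)).unop u =
        (KQ.fromOpcycles (i + 1) i).unop b := by
      have hinj : Function.Injective (KQ.pOpcycles (i + 1)).unop := by
        rw [← ModuleCat.mono_iff_injective]
        infer_instance
      apply hinj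
      have e1 := congrArg (fun k => k.unop u) (HomologicalComplex.p_opcyclesMap ψ (i + 1))
      have e2 := congrArg (fun k => k.unop b) (KQ.p_fromOpcycles (i + 1) i)
      exact e1.trans (hb.trans e2.symm)
    have h4 := congrArg (fun k => k.unop b) (KQ.homologyι_comp_fromOpcycles (i + 1) i)
    have h5 : ((F.leftDerived (i + 1)).map θ).unop (f₁ u) =
      isoQ.hom.unop ((KQ.homologyι (i + 1)).unop
        ((HomologicalComplex.opcyclesMap ψ (i + 1)).unop u)) := h2
    have h6 : (KQ.homologyι (i + 1)).unop ((KQ.fromOpcycles (i + 1) i).unop b) = 0 := h4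
    rw [h3, h6, map_zero] at h5
    subst hu
    exact h5

open Limits Opposite in
theorem GIaux_colim {R : Type u} [CommRing R] (a : Ideal R) (i : ℕ) (G : ModuleCat.{u} R)
    (H : ∀ (n : ℕ) (x : ((Ext R (ModuleCat.{u} R) i).obj
      (op (ModuleCat.of R (R ⧸ a ^ n)))).obj G),
      ∃ (m : ℕ) (h : n ≤ m), ((Ext R (ModuleCat.{u} R) i).map
        (ModuleCat.ofHom (Submodule.mapQ (a ^ m) (a ^ n) LinearMap.id
          (Ideal.pow_le_pow_right h))).op).app G x = 0) :
    IsZero ((localCohomology a i).obj G) := by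
  have := localCohomology.hasColimitDiagram.{u, 0} (localCohomology.idealPowersDiagram a) i
  let D := localCohomology.diagram (localCohomology.idealPowersDiagram a) i
  let hc := isColimitOfPreserves ((evaluation (ModuleCat.{u} R) (ModuleCat.{u} R)).obj G)
    (colimit.isColimit D)
  change IsZero (((evaluation (ModuleCat.{u} R) (ModuleCat.{u} R)).obj G).mapCocone
      (colimit.cocone D)).pt
  rw [IsZero.iff_id_eq_zero]
  apply hc.hom_ext
  intro j
  rw [Category.comp_id, comp_zero]
  ext x
  obtain ⟨m, h, hx⟩ := H (unop (unop j)) x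
  let f : j ⟶ op (op m) := (homOfLE h).op.op
  have w := (((evaluation (ModuleCat.{u} R) (ModuleCat.{u} R)).obj G).mapCocone
    (colimit.cocone D)).w f
  have hx' : (D ⋙ (evaluation (ModuleCat.{u} R) (ModuleCat.{u} R)).obj G).map f x = 0 := hx
  have w' := congrArg (fun k => ModuleCat.Hom.hom k x) w
  refine w'.symm.trans ?_
  refine (congrArg (ModuleCat.Hom.hom ((((evaluation (ModuleCat.{u} R)
    (ModuleCat.{u} R)).obj G).mapCocone (colimit.cocone D)).ι.app (op (op m)))) hx').trans ?_
  exact map_zero _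

/-- over a noetherian ring, local cohomology of a Gorenstein injective
module vanishes in positive degrees. -/
theorem localCohomology_isZero_of_gorensteinInjective
    {R : Type u} [CommRing R] [IsNoetherianRing R] (a : Ideal R)
    (G : Type u) [AddCommGroup G] [Module R G]
    (hG : IsGorensteinInjective R G) :
    ∀ i : ℕ, 0 < i → Limits.IsZero ((localCohomology a i).obj (ModuleCat.of R G)) := by
  intro i hi
  obtain ⟨i, rfl⟩ : ∃ k, i = k + 1 := ⟨i - 1, by omega⟩
  obtain ⟨D⟩ := hG
  let _ := D.acg
  let _ := D.mod
  apply GIaux_colim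
  intro n x
  let P := projectiveResolution (ModuleCat.of R (R ⧸ a ^ n))
  obtain ⟨c, hc, H⟩ := GIaux_ext (i := i) _ _ P x
  let ι : G →ₗ[R] D.E (-1 + 1) := (Submodule.subtype _).comp D.equiv.toLinearMap
  have hι : (D.d (-1)).comp ι = 0 := by
    ext g
    exact (D.equiv g).2
  let ε : P.complex.X 0 →ₗ[R] (R ⧸ a ^ n) := (P.π.f 0).hom
  obtain ⟨k, z, hz, K⟩ := GIaux_core D.E D.d D.inj D.exact (fun i => P.complex.X i)
    (fun i => (P.complex.d (i + 1) i).hom)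
    (fun i => (ShortComplex.moduleCat_exact_iff_range_eq_ker _).1 (P.exact_succ i))
    (R ⧸ a ^ n) ε
    ((ModuleCat.epi_iff_surjective (P.π.f 0)).1 inferInstance)
    ((ShortComplex.moduleCat_exact_iff_range_eq_ker _).1 P.exact₀)
    i (-1) (ι.comp c.hom)
    (by rw [← LinearMap.comp_assoc, hι, LinearMap.zero_comp])
    (by
      rw [LinearMap.comp_assoc, ← ModuleCat.hom_comp, hc]
      simp)
  obtain ⟨y, hy, m, hnm, hm⟩ := GIaux_exact_ideal a D.E D.d D.inj D.exact k
    (z (Submodule.Quotient.mk 1)) (LinearMap.congr_fun hz _) n (by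
      intro r hr
      rw [← map_smul, ← Submodule.Quotient.mk_smul, smul_eq_mul, mul_one,
        (Submodule.Quotient.mk_eq_zero _).2 hr, map_zero])
  refine ⟨m, hnm, ?_⟩
  set θ : (R ⧸ a ^ m) →ₗ[R] (R ⧸ a ^ n) := Submodule.mapQ (a ^ m) (a ^ n) LinearMap.id
          (Ideal.pow_le_pow_right hnm) with hθ
  let Q := projectiveResolution (ModuleCat.of R (R ⧸ a ^ m))
  let φ := ProjectiveResolution.lift (ModuleCat.ofHom θ) Q P
  let ε' : Q.complex.X 0 →ₗ[R] (R ⧸ a ^ m) := (Q.π.f 0).hom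
  obtain ⟨b, hb, hb2⟩ := K (fun i => Q.complex.X i) (fun i => (Q.complex.d (i + 1) i).hom)
    (fun i => (IsProjective.iff_projective _).2 (Q.projective i))
    (fun i => by rw [← ModuleCat.hom_comp, Q.complex.d_comp_d]; rfl)
    (R ⧸ a ^ m) ε'
    (congrArg ModuleCat.Hom.hom Q.complex_d_comp_π_f_zero)
    (fun i => (φ.f i).hom)
    (fun i => by rw [← ModuleCat.hom_comp, ← ModuleCat.hom_comp, φ.comm])
    θ
    (by
      have := ProjectiveResolution.lift_commutes_zero (ModuleCat.ofHom θ) Q P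
      exact (congrArg ModuleCat.Hom.hom this).symm)
    ⟨Submodule.liftQ _ (LinearMap.toSpanSingleton R _ y) (fun r hr => by simpa using hm r hr), by
      apply LinearMap.ext
      intro t
      obtain ⟨r, rfl⟩ := Submodule.Quotient.mk_surjective _ t
      simp only [LinearMap.comp_apply, Submodule.liftQ_apply, LinearMap.toSpanSingleton_apply,
        map_smul, hy, hθ, Submodule.mapQ_apply, LinearMap.id_apply]
      rw [← map_smul, ← Submodule.Quotient.mk_smul, smul_eq_mul, mul_one]⟩
  let b' : Q.complex.X i →ₗ[R] G := D.equiv.symm.toLinearMap.comp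
    (LinearMap.codRestrict (LinearMap.ker (D.d (-1))) b (fun q => LinearMap.congr_fun hb q))
  have hb' : ι.comp b' = b := by
    ext q
    simp only [ι, b', LinearMap.comp_apply, LinearEquiv.coe_coe, LinearEquiv.apply_symm_apply]
    rfl
  have hιinj : Function.Injective ι :=
    (Submodule.injective_subtype _).comp D.equiv.injective
  refine H _ (ModuleCat.ofHom θ) Q φ (ProjectiveResolution.lift_commutes _ Q P)
    (ModuleCat.ofHom b') ?_
  ext q
  apply hιinj
  have h1 := LinearMap.congr_fun hb2 q
  rw [← hb'] at h1
  exact h1.symm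
end

section
/- Let R be a commutative noetherian ring admitting a dualizing module D, let a be an ideal of R, and let G be a Gorenstein injective R-module. Then the a-torsion submodule Γ_a(G) is a Gorenstein injective R-module. -/
open CategoryTheory

universe u

/-- An exact complex of injectives. -/
structure GIC (R : Type u) [CommRing R] where
  E : ℤ → Type u
  [acg : ∀ i, AddCommGroup (E i)]
  [mod : ∀ i, Module R (E i)]
  d : ∀ i : ℤ, E (i + 1) →ₗ[R] E i
  inj : ∀ i, Module.Injective R (E i)
  exact : ∀ i : ℤ, LinearMap.range (d (i + 1)) = LinearMap.ker (d i)

attribute [instance] GIC.acg GIC.mod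

namespace GIC

variable {R : Type u} [CommRing R] (c : GIC R)

/-- Hom(M, E) is exact. -/
def HX (M : Type u) [AddCommGroup M] [Module R M] : Prop :=
  ∀ (i : ℤ) (g : M →ₗ[R] c.E (i + 1)), (c.d i).comp g = 0 →
    ∃ f : M →ₗ[R] c.E (i + 1 + 1), (c.d (i + 1)).comp f = g

theorem dd (i : ℤ) (x : c.E (i + 1 + 1)) : c.d i (c.d (i + 1) x) = 0 := by
  have : c.d (i + 1) x ∈ LinearMap.ker (c.d i) := by
    rw [← c.exact]; exact ⟨x, rfl⟩
  exact this

theorem ddc (i : ℤ) : (c.d i).comp (c.d (i + 1)) = 0 := by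
  ext x; exact c.dd i x

variable {A B C : Type u} [AddCommGroup A] [Module R A] [AddCommGroup B] [Module R B]
  [AddCommGroup C] [Module R C]

theorem fac_of_exact {V : Type u} [AddCommGroup V] [Module R V] {p : B →ₗ[R] C} {i : A →ₗ[R] B}
    (hp : Function.Surjective p) (he : Function.Exact i p) (g : B →ₗ[R] V) (hg : g.comp i = 0) :
    ∃ g' : C →ₗ[R] V, g'.comp p = g := by
  have hker : LinearMap.ker p ≤ LinearMap.ker g := by
    intro x hx
    obtain ⟨y, rfl⟩ := (he x).1 hx
    exact LinearMap.congr_fun hg y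
  refine ⟨((LinearMap.ker p).liftQ g hker).comp (p.quotKerEquivOfSurjective hp).symm.toLinearMap, ?_⟩
  ext x
  have : (p.quotKerEquivOfSurjective hp).symm (p x) = (LinearMap.ker p).mkQ x := by
    rw [LinearEquiv.symm_apply_eq]; rfl
  simp [this]

theorem HX.quot {i : A →ₗ[R] B} {p : B →ₗ[R] C} (hi : Function.Injective i)
    (hp : Function.Surjective p) (he : Function.Exact i p) (hA : c.HX A) (hB : c.HX B) :
    c.HX C := by
  intro n f hf
  have hpi : p.comp i = 0 := by ext x; exact he.apply_apply_eq_zero x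
  obtain ⟨g, hg⟩ := hB n (f.comp p) (by rw [← LinearMap.comp_assoc, hf, LinearMap.zero_comp])
  obtain ⟨h, hh⟩ := hA (n + 1) (g.comp i) (by
    rw [← LinearMap.comp_assoc, hg, LinearMap.comp_assoc, hpi, LinearMap.comp_zero])
  have := c.inj (n + 1 + 1 + 1)
  obtain ⟨h', hh'⟩ := Module.Injective.extension_property R _ _ _ i hi h
  obtain ⟨g', hg'⟩ := fac_of_exact hp he (g - (c.d (n + 1 + 1)).comp h') (by
    rw [LinearMap.sub_comp, LinearMap.comp_assoc, hh', hh, sub_self])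
  refine ⟨g', ?_⟩
  rw [← LinearMap.cancel_right hp, LinearMap.comp_assoc, hg', LinearMap.comp_sub, hg,
    ← LinearMap.comp_assoc, c.ddc, LinearMap.zero_comp, sub_zero]

theorem HX.sub {i : A →ₗ[R] B} {p : B →ₗ[R] C} (hi : Function.Injective i)
    (hp : Function.Surjective p) (he : Function.Exact i p) (hB : c.HX B) (hC : c.HX C) :
    c.HX A := by
  intro n f hf
  obtain ⟨m, rfl⟩ : ∃ m, n = m + 1 := ⟨n - 1, by ring⟩
  have hpi : p.comp i = 0 := by ext x; exact he.apply_apply_eq_zero x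
  have := c.inj (m + 1 + 1)
  obtain ⟨f', hf'⟩ := Module.Injective.extension_property R _ _ _ i hi f
  obtain ⟨k, hk⟩ := fac_of_exact hp he ((c.d (m + 1)).comp f') (by
    rw [LinearMap.comp_assoc, hf', hf])
  obtain ⟨l, hl⟩ := hC m k (by
    rw [← LinearMap.cancel_right hp, LinearMap.comp_assoc, hk, ← LinearMap.comp_assoc, c.ddc,
      LinearMap.zero_comp, LinearMap.zero_comp])
  obtain ⟨q, hq⟩ := hB (m + 1) (f' - l.comp p) (by
    rw [LinearMap.comp_sub, ← LinearMap.comp_assoc, hl, hk, sub_self])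
  refine ⟨q.comp i, ?_⟩
  rw [← LinearMap.comp_assoc, hq, LinearMap.sub_comp, hf', LinearMap.comp_assoc, hpi,
    LinearMap.comp_zero, sub_zero]

theorem HX.retract (s : A →ₗ[R] B) (r : B →ₗ[R] A) (h : r.comp s = LinearMap.id) (hB : c.HX B) :
    c.HX A := by
  intro n f hf
  obtain ⟨g, hg⟩ := hB n (f.comp r) (by rw [← LinearMap.comp_assoc, hf, LinearMap.zero_comp])
  exact ⟨g.comp s, by rw [← LinearMap.comp_assoc, hg, LinearMap.comp_assoc, h, LinearMap.comp_id]⟩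

theorem HX.equiv (e : A ≃ₗ[R] B) (hB : c.HX B) : c.HX A :=
  HX.retract c e.toLinearMap e.symm.toLinearMap (by ext; simp) hB

theorem HX.finsupp (X : Type u) (hA : c.HX A) : c.HX (X →₀ A) := by
  intro n f hf
  choose g hg using fun x : X => hA n (f.comp (Finsupp.lsingle x)) (by
    rw [← LinearMap.comp_assoc, hf, LinearMap.zero_comp])
  refine ⟨Finsupp.lsum ℕ g, ?_⟩
  ext x a
  have := LinearMap.congr_fun (hg x) a
  simpa using this

theorem HX.self : c.HX R := by
  intro n f hf
  have : f 1 ∈ LinearMap.range (c.d (n + 1)) := by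
    rw [c.exact]; exact LinearMap.congr_fun hf 1
  obtain ⟨y, hy⟩ := this
  exact ⟨LinearMap.toSpanSingleton R _ y, by ext; simp [hy]⟩

end GIC

section torsion

variable {R : Type u} [CommRing R]

theorem mem_tG {M : Type u} [AddCommGroup M] [Module R M] (a : Ideal R) (y : M) :
    y ∈ torsionGamma a M ↔ ∃ n : ℕ, ∀ r ∈ a ^ n, r • y = 0 := by
  unfold torsionGamma
  rw [Submodule.mem_iSup_of_directed]
  · simp [Submodule.mem_torsionBySet_iff]
  · intro n m
    refine ⟨max n m, ?_, ?_⟩ <;> intro z hz <;> rw [Submodule.mem_torsionBySet_iff] at * <;>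
      rintro ⟨r, hr⟩
    · exact hz ⟨r, Ideal.pow_le_pow_right (le_max_left n m) hr⟩
    · exact hz ⟨r, Ideal.pow_le_pow_right (le_max_right n m) hr⟩

theorem mem_tG_span {M : Type u} [AddCommGroup M] [Module R M] (x : R) (y : M) :
    y ∈ torsionGamma (Ideal.span {x}) M ↔ ∃ n : ℕ, x ^ n • y = 0 := by
  rw [mem_tG]
  refine exists_congr fun n => ?_
  rw [Ideal.span_singleton_pow]
  constructor
  · intro h; exact h _ (Ideal.mem_span_singleton_self _)
  · intro h r hr
    obtain ⟨s, rfl⟩ := Ideal.mem_span_singleton'.1 hr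
    rw [mul_smul, h, smul_zero]

theorem tG_map {M N : Type u} [AddCommGroup M] [Module R M] [AddCommGroup N] [Module R N]
    (a : Ideal R) (f : M →ₗ[R] N) {y : M} (hy : y ∈ torsionGamma a M) :
    f y ∈ torsionGamma a N := by
  rw [mem_tG] at *
  obtain ⟨n, hn⟩ := hy
  exact ⟨n, fun r hr => by rw [← map_smul, hn r hr, map_zero]⟩

theorem tG_of_inj {M N : Type u} [AddCommGroup M] [Module R M] [AddCommGroup N] [Module R N]
    (a : Ideal R) (f : M →ₗ[R] N) (hf : Function.Injective f) {y : M}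
    (hy : f y ∈ torsionGamma a N) : y ∈ torsionGamma a M := by
  rw [mem_tG] at *
  obtain ⟨n, hn⟩ := hy
  exact ⟨n, fun r hr => hf (by rw [map_smul, hn r hr, map_zero])⟩

/-- functoriality -/
def tGMap {M N : Type u} [AddCommGroup M] [Module R M] [AddCommGroup N] [Module R N]
    (a : Ideal R) (f : M →ₗ[R] N) : torsionGamma a M →ₗ[R] torsionGamma a N :=
  f.restrict fun _ hy => tG_map a f hy

theorem tG_equiv {M N : Type u} [AddCommGroup M] [Module R M] [AddCommGroup N] [Module R N]
    (a : Ideal R) (e : M ≃ₗ[R] N) : Nonempty (torsionGamma a M ≃ₗ[R] torsionGamma a N) :=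
  ⟨LinearEquiv.ofLinearMap (tGMap a e.toLinearMap) (tGMap a e.symm.toLinearMap)
    (by ext x; simp [tGMap]) (by ext x; simp [tGMap])⟩

theorem mem_tG_sup {M : Type u} [AddCommGroup M] [Module R M] (a b : Ideal R) (y : M) :
    y ∈ torsionGamma (a ⊔ b) M ↔ y ∈ torsionGamma a M ∧ y ∈ torsionGamma b M := by
  simp only [mem_tG]
  constructor
  · rintro ⟨n, hn⟩
    exact ⟨⟨n, fun r hr => hn r (Ideal.pow_right_mono le_sup_left n hr)⟩,
      ⟨n, fun r hr => hn r (Ideal.pow_right_mono le_sup_right n hr)⟩⟩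
  · rintro ⟨⟨n, hn⟩, ⟨m, hm⟩⟩
    refine ⟨n + m, fun r hr => ?_⟩
    obtain ⟨s, hs, t, ht, rfl⟩ := Submodule.mem_sup.1 (Ideal.sup_pow_add_le_pow_sup_pow hr)
    rw [add_smul, hn s hs, hm t ht, add_zero]

theorem tG_sup_fwd {M : Type u} [AddCommGroup M] [Module R M] (a b : Ideal R)
    (y : M) (hy : y ∈ torsionGamma (a ⊔ b) M) :
    (⟨y, ((mem_tG_sup a b y).1 hy).1⟩ : torsionGamma a M) ∈ torsionGamma b (torsionGamma a M) := by
  rw [mem_tG]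
  obtain ⟨n, hn⟩ := (mem_tG b y).1 ((mem_tG_sup a b y).1 hy).2
  exact ⟨n, fun r hr => Subtype.ext (hn r hr)⟩

theorem tG_sup_bwd {M : Type u} [AddCommGroup M] [Module R M] (a b : Ideal R)
    (y : torsionGamma a M) (hy : y ∈ torsionGamma b (torsionGamma a M)) :
    (y : M) ∈ torsionGamma (a ⊔ b) M := by
  rw [mem_tG_sup]
  refine ⟨y.2, ?_⟩
  obtain ⟨n, hn⟩ := (mem_tG b y).1 hy
  rw [mem_tG]
  exact ⟨n, fun r hr => congrArg Subtype.val (hn r hr)⟩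

theorem sub_sub_equiv {M : Type u} [AddCommGroup M] [Module R M] (N₁ N₂ : Submodule R M)
    (N₃ : Submodule R N₁) (h₁ : ∀ y ∈ N₂, y ∈ N₁) (h₂ : ∀ y (hy : y ∈ N₂), ⟨y, h₁ y hy⟩ ∈ N₃)
    (h₃ : ∀ y : N₁, y ∈ N₃ → (y : M) ∈ N₂) : Nonempty (N₂ ≃ₗ[R] N₃) :=
  ⟨{ toFun := fun y => ⟨⟨y.1, h₁ y.1 y.2⟩, h₂ y.1 y.2⟩
     map_add' := fun _ _ => rfl
     map_smul' := fun _ _ => rfl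
     invFun := fun y => ⟨y.1.1, h₃ y.1 y.2⟩
     left_inv := fun _ => rfl
     right_inv := fun _ => rfl }⟩

theorem tG_sup_equiv {M : Type u} [AddCommGroup M] [Module R M] (a b : Ideal R) :
    Nonempty (torsionGamma (a ⊔ b) M ≃ₗ[R] torsionGamma b (torsionGamma a M)) :=
  sub_sub_equiv _ _ _ (fun y hy => ((mem_tG_sup a b y).1 hy).1) (tG_sup_fwd a b) (tG_sup_bwd a b)

theorem tG_injective [IsNoetherianRing R] (a : Ideal R) (J : Type u) [AddCommGroup J] [Module R J]
    [Module.Injective R J] : Module.Injective R (torsionGamma a J) := by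
  apply Module.Baer.injective
  intro b f
  -- uniform annihilation
  have hfg : ∃ n : ℕ, ∀ r ∈ a ^ n, ∀ y : b, r • f y = 0 := by
    have hb : (⊤ : Submodule R b).FG := IsNoetherian.noetherian _
    obtain ⟨s, hs⟩ := hb
    choose n hn using fun y : b => (mem_tG a (f y : J)).1 (f y).2
    refine ⟨s.sup n, fun r hr y => ?_⟩
    have : (⊤ : Submodule R b) ≤ LinearMap.ker (r • f) := by
      rw [← hs, Submodule.span_le]
      intro z hz
      have := hn z r (Ideal.pow_le_pow_right (Finset.le_sup hz) hr)
      simp only [SetLike.mem_coe, LinearMap.mem_ker, LinearMap.smul_apply]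
      exact Subtype.ext this
    exact this (Submodule.mem_top (x := y))
  obtain ⟨n, hn⟩ := hfg
  obtain ⟨k, hk⟩ := Ideal.exists_pow_inf_eq_pow_smul a b
  have hk' := hk (n + k) (Nat.le_add_left _ _)
  have key : ∀ (z : R) (hz : z ∈ b), z ∈ a ^ (n + k) → f ⟨z, hz⟩ = 0 := by
    intro z hz hza
    have h1 : z ∈ a ^ (n + k) • (⊤ : Submodule R R) ⊓ b := ⟨by simpa using hza, hz⟩
    rw [hk', Nat.add_sub_cancel] at h1
    have h2 : z ∈ a ^ n • b := Submodule.smul_mono le_rfl inf_le_right h1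
    have H : a ^ n • b ≤ Submodule.map b.subtype (LinearMap.ker f) := by
      rw [Submodule.smul_le]
      intro r hr m hm
      exact ⟨r • ⟨m, hm⟩, by simp only [SetLike.mem_coe, LinearMap.mem_ker, map_smul, hn r hr],
        rfl⟩
    obtain ⟨w, hw, hwz⟩ := H h2
    have : (⟨z, hz⟩ : b) = w := Subtype.ext hwz.symm
    rw [this]; exact hw
  -- extend through quotient
  let q : b →ₗ[R] R ⧸ (a ^ (n + k)) := (Submodule.mkQ _).comp b.subtype
  have hq : LinearMap.ker q ≤ LinearMap.ker ((torsionGamma a J).subtype.comp f) := by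
    rintro ⟨z, hz⟩ h
    have h1 : z ∈ a ^ (n + k) := Ideal.Quotient.eq_zero_iff_mem.1 h
    simp [key z hz h1]
  let g : (b ⧸ LinearMap.ker q) →ₗ[R] J := (LinearMap.ker q).liftQ _ hq
  let i : (b ⧸ LinearMap.ker q) →ₗ[R] R ⧸ (a ^ (n + k)) := (LinearMap.ker q).liftQ q le_rfl
  have hi : Function.Injective i := by
    rw [← LinearMap.ker_eq_bot]; exact Submodule.ker_liftQ_eq_bot _ _ _ le_rfl
  obtain ⟨h, hh⟩ := Module.Injective.extension_property R _ _ _ i hi g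
  refine ⟨LinearMap.codRestrict _ (h.comp (Submodule.mkQ _)) fun y => ?_, fun z hz => ?_⟩
  · rw [mem_tG]
    refine ⟨n + k, fun r hr => ?_⟩
    rw [← map_smul, LinearMap.comp_apply]
    have : Submodule.mkQ (a ^ (n + k)) (r • y) = 0 := Ideal.Quotient.eq_zero_iff_mem.2 (Ideal.mul_mem_right _ _ hr)
    rw [this, map_zero]
  · ext
    have := LinearMap.congr_fun hh (Submodule.Quotient.mk ⟨z, hz⟩)
    simpa [i, g, q] using this

theorem inj_div [IsNoetherianRing R] (x : R) (J : Type u) [AddCommGroup J] [Module R J]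
    [Module.Injective R J] (e : J) : ∃ (e' : J) (k : ℕ), x ^ k • (x • e' - e) = 0 := by
  obtain ⟨k, hk⟩ := monotone_stabilizes_iff_noetherian.2 ‹IsNoetherianRing R›
    ⟨fun n => LinearMap.ker (LinearMap.lsmul R R (x ^ n)), fun n m h z hz => by
      obtain ⟨t, rfl⟩ := Nat.exists_eq_add_of_le h
      simp only [LinearMap.mem_ker, LinearMap.lsmul_apply, smul_eq_mul] at *
      rw [pow_add, mul_comm (x ^ n), mul_assoc, hz, mul_zero]⟩
  have hk1 := hk (k + 1) (Nat.le_succ k)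
  change LinearMap.ker (LinearMap.lsmul R R (x ^ k)) = LinearMap.ker (LinearMap.lsmul R R (x ^ (k + 1))) at hk1
  have hker : LinearMap.ker (LinearMap.lsmul R R (x ^ (k + 1))) ≤
      LinearMap.ker (LinearMap.toSpanSingleton R J (x ^ k • e)) := by
    intro z hz
    rw [← hk1] at hz
    simp only [LinearMap.mem_ker, LinearMap.lsmul_apply, smul_eq_mul,
      LinearMap.toSpanSingleton_apply] at *
    rw [← mul_smul, mul_comm, hz, zero_smul]
  obtain ⟨h, hh⟩ := Module.Injective.extension_property R _ _ _
    ((LinearMap.ker (LinearMap.lsmul R R (x ^ (k + 1)))).liftQ (LinearMap.lsmul R R (x ^ (k + 1))) le_rfl)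
    (by rw [← LinearMap.ker_eq_bot]; exact Submodule.ker_liftQ_eq_bot _ _ _ le_rfl)
    ((LinearMap.ker (LinearMap.lsmul R R (x ^ (k + 1)))).liftQ _ hker)
  have := LinearMap.congr_fun hh (Submodule.Quotient.mk 1)
  simp only [LinearMap.comp_apply, Submodule.liftQ_apply, LinearMap.lsmul_apply,
    LinearMap.toSpanSingleton_apply, one_smul, map_smul] at this
  refine ⟨h 1, k, ?_⟩
  rw [smul_sub, ← mul_smul, ← pow_succ, this, sub_self]

theorem ker_pow_smul_fg {M N : Type u} [AddCommGroup M] [Module R M] [AddCommGroup N] [Module R N]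
    [Module.Finite R M] (x : R) (f : M →ₗ[R] N) (h : ∀ m, f m ∈ torsionGamma (Ideal.span {x}) N) :
    ∃ k : ℕ, x ^ k • f = 0 := by
  obtain ⟨s, hs⟩ := Module.Finite.fg_top (R := R) (M := M)
  choose n hn using fun y : M => (mem_tG_span x (f y)).1 (h y)
  refine ⟨s.sup n, ?_⟩
  rw [← LinearMap.ker_eq_top, ← top_le_iff, ← hs, Submodule.span_le]
  intro z hz
  obtain ⟨t, ht⟩ := Nat.exists_eq_add_of_le (Finset.le_sup (f := n) hz)
  simp [ht, pow_add, mul_comm (x ^ n z), mul_smul, hn]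

theorem hom_div [IsNoetherianRing R] (x : R) (J : Type u) [AddCommGroup J] [Module R J]
    [Module.Injective R J] {M : Type u} [AddCommGroup M] [Module R M] [Module.Finite R M]
    (h : M →ₗ[R] J) (m : ℕ) : ∃ (h' : M →ₗ[R] J) (k : ℕ), x ^ k • (x ^ m • h' - h) = 0 := by
  have := tG_injective (Ideal.span {x}) J
  obtain ⟨ρ, hρ⟩ := Module.Injective.extension_property R _ _ _
    (torsionGamma (Ideal.span {x}) J).subtype (Submodule.injective_subtype _) LinearMap.id
  have hρ' : ∀ y (hy : y ∈ torsionGamma (Ideal.span {x}) J), ρ y = ⟨y, hy⟩ := fun y hy =>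
    LinearMap.congr_fun hρ ⟨y, hy⟩
  let K := LinearMap.ker ρ
  let π : J →ₗ[R] K := LinearMap.codRestrict K (LinearMap.id - (Submodule.subtype _).comp ρ)
    (fun y => by
      simp only [K, LinearMap.mem_ker, LinearMap.sub_apply, LinearMap.id_apply, map_sub,
        LinearMap.comp_apply, Submodule.subtype_apply]
      rw [hρ' (ρ y : J) (ρ y).2, sub_self])
  have hπ : ∀ y, (π y : J) = y - ρ y := fun y => rfl
  have hbij : Function.Bijective (LinearMap.lsmul R K x) := by
    constructor
    · rw [← LinearMap.ker_eq_bot, LinearMap.ker_eq_bot']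
      rintro ⟨y, hy⟩ h0
      have h1 : x • y = 0 := congrArg Subtype.val h0
      have h2 : y ∈ torsionGamma (Ideal.span {x}) J := (mem_tG_span x y).2 ⟨1, by simpa using h1⟩
      have h3 := hρ' y h2
      rw [LinearMap.mem_ker.1 hy] at h3
      exact Subtype.ext (congrArg Subtype.val h3).symm
    · rintro ⟨y, hy⟩
      obtain ⟨e, k, hk⟩ := inj_div x J y
      have h2 : x • e - y ∈ torsionGamma (Ideal.span {x}) J := (mem_tG_span x _).2 ⟨k, hk⟩
      refine ⟨π e, Subtype.ext ?_⟩
      have h3 := congrArg Subtype.val (hρ' _ h2)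
      have hy' : ρ y = 0 := hy
      simp only [map_sub, hy', sub_zero, map_smul, Submodule.coe_smul] at h3
      simp only [LinearMap.lsmul_apply, Submodule.coe_smul, hπ, smul_sub, h3]
      abel
  let u : K ≃ₗ[R] K := LinearEquiv.ofBijective _ hbij
  have hu : ∀ (m : ℕ), ∃ g : K →ₗ[R] K, ∀ y, x ^ m • g y = y := by
    intro m
    induction m with
    | zero => exact ⟨LinearMap.id, by simp⟩
    | succ m ih =>
      obtain ⟨g, hg⟩ := ih
      refine ⟨u.symm.toLinearMap.comp g, fun y => ?_⟩
      have : x • u.symm (g y) = g y := u.apply_symm_apply (g y)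
      rw [pow_succ, mul_smul, LinearMap.comp_apply, LinearEquiv.coe_coe, this, hg]
  obtain ⟨g, hg⟩ := hu m
  obtain ⟨k, hk⟩ := ker_pow_smul_fg x (((Submodule.subtype _).comp ρ).comp h) (fun y => (ρ (h y)).2)
  refine ⟨K.subtype.comp (g.comp (π.comp h)), k, ?_⟩
  ext y
  have h1 : x ^ m • (g (π (h y)) : J) = π (h y) := congrArg Subtype.val (hg (π (h y)))
  have h2 := LinearMap.congr_fun hk y
  simp only [LinearMap.smul_apply, LinearMap.sub_apply, LinearMap.comp_apply,
    Submodule.subtype_apply, LinearMap.zero_apply] at h2 ⊢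
  rw [h1, hπ, sub_sub_cancel_left, smul_neg, h2, neg_zero]

end torsion

namespace GIC

variable {R : Type u} [CommRing R] [IsNoetherianRing R] (c : GIC R)

theorem gam_lift (x : R) {M : Type u} [AddCommGroup M] [Module R M] [Module.Finite R M]
    (hM : c.HX M) (i : ℤ) (g : M →ₗ[R] c.E (i + 1))
    (hg : ∀ m, g m ∈ torsionGamma (Ideal.span {x}) (c.E (i + 1))) (h0 : (c.d i).comp g = 0) :
    ∃ f : M →ₗ[R] c.E (i + 1 + 1), (∀ m, f m ∈ torsionGamma (Ideal.span {x}) (c.E (i + 1 + 1))) ∧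
      (c.d (i + 1)).comp f = g := by
  obtain ⟨f, hf⟩ := hM i g h0
  obtain ⟨m, hm⟩ := ker_pow_smul_fg x g hg
  obtain ⟨h, hh⟩ := hM (i + 1) (x ^ m • f) (by rw [LinearMap.comp_smul, hf, hm])
  have := c.inj (i + 1 + 1 + 1)
  obtain ⟨h', k, hk⟩ := hom_div x _ h m
  refine ⟨f - (c.d (i + 1 + 1)).comp h', fun y => ?_, ?_⟩
  · rw [mem_tG_span]
    refine ⟨k + m, ?_⟩
    have h1 := LinearMap.congr_fun hh y
    have h2 := congrArg (c.d (i + 1 + 1)) (LinearMap.congr_fun hk y)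
    simp only [LinearMap.smul_apply, LinearMap.sub_apply, LinearMap.comp_apply, map_smul, map_sub,
      LinearMap.zero_apply, map_zero] at h1 h2 ⊢
    rw [h1, ← neg_eq_zero, ← smul_neg, neg_sub, ← smul_sub, ← mul_smul, ← pow_add] at h2
    rw [← h2]
  · rw [LinearMap.comp_sub, hf, ← LinearMap.comp_assoc, c.ddc, LinearMap.zero_comp, sub_zero]

/-- torsion subcomplex -/
def gam (x : R) : GIC R where
  E i := torsionGamma (Ideal.span {x}) (c.E i)
  d i := tGMap (Ideal.span {x}) (c.d i)
  inj i := by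
    have := c.inj i
    exact tG_injective _ _
  exact i := by
    apply le_antisymm
    · rintro _ ⟨y, rfl⟩
      exact Subtype.ext (c.dd i y.1)
    · rintro ⟨y, hy⟩ h
      have h0 : c.d i y = 0 := congrArg Subtype.val h
      obtain ⟨f, hf, hf'⟩ := c.gam_lift x (HX.self c) i (LinearMap.toSpanSingleton R _ y)
        (fun m => Submodule.smul_mem _ _ hy) (by ext; simp [h0])
      refine ⟨⟨f 1, hf 1⟩, Subtype.ext ?_⟩
      have := LinearMap.congr_fun hf' 1
      simpa [tGMap] using this

theorem gam_HX (x : R) {M : Type u} [AddCommGroup M] [Module R M] [Module.Finite R M]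
    (hM : c.HX M) : (c.gam x).HX M := by
  intro i g hg
  obtain ⟨f, hf, hf'⟩ := c.gam_lift x hM i ((Submodule.subtype _).comp g) (fun m => (g m).2) (by
    ext y
    exact congrArg Subtype.val (LinearMap.congr_fun hg y))
  refine ⟨LinearMap.codRestrict _ f hf, ?_⟩
  ext y
  exact Subtype.ext (LinearMap.congr_fun hf' y)

theorem gam_ker (x : R) (i : ℤ) :
    Nonempty (torsionGamma (Ideal.span {x}) (LinearMap.ker (c.d i)) ≃ₗ[R]
      LinearMap.ker ((c.gam x).d i)) := by
  let N : Submodule R (c.E (i + 1)) := torsionGamma (Ideal.span {x}) (c.E (i + 1)) ⊓ LinearMap.ker (c.d i)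
  obtain ⟨e₁⟩ : Nonempty (N ≃ₗ[R] torsionGamma (Ideal.span {x}) (LinearMap.ker (c.d i))) :=
    sub_sub_equiv _ N _ (fun y hy => hy.2)
      (fun y hy => tG_of_inj _ (Submodule.subtype _) (Submodule.injective_subtype _) hy.1)
      (fun y hy => ⟨tG_map _ (Submodule.subtype _) hy, y.2⟩)
  obtain ⟨e₂⟩ : Nonempty (N ≃ₗ[R] LinearMap.ker (tGMap (Ideal.span {x}) (c.d i))) :=
    sub_sub_equiv _ N _ (fun y hy => hy.1)
      (fun y hy => Subtype.ext hy.2)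
      (fun y hy => ⟨y.2, congrArg Subtype.val hy⟩)
  exact ⟨e₁.symm.trans e₂⟩

/-- weak Gorenstein injectivity relative to `D` -/
def Weak (D : Type u) [AddCommGroup D] [Module R D] (G : Type u) [AddCommGroup G] [Module R G] :
    Prop := ∃ c : GIC R, c.HX D ∧ Nonempty (G ≃ₗ[R] LinearMap.ker (c.d (-1)))

theorem Weak.gam {D : Type u} [AddCommGroup D] [Module R D] [Module.Finite R D]
    (a : Ideal R) {G : Type u} [AddCommGroup G] [Module R G] (hG : Weak (R := R) D G) :
    Weak (R := R) D (torsionGamma a G) := by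
  have ha : a.FG := IsNoetherian.noetherian a
  revert G
  induction a, ha using Submodule.fg_induction with
  | singleton x =>
    rintro G _ _ ⟨c, hc, ⟨e⟩⟩
    obtain ⟨e₁⟩ := tG_equiv (Ideal.span {x}) e
    obtain ⟨e₂⟩ := c.gam_ker x (-1)
    exact ⟨c.gam x, c.gam_HX x hc, ⟨e₁.trans e₂⟩⟩
  | sup a b ha hb iha ihb =>
    intro G _ _ hG
    obtain ⟨c, hc, ⟨e⟩⟩ := ihb (iha hG)
    obtain ⟨e₁⟩ := tG_sup_equiv (M := G) a b
    exact ⟨c, hc, ⟨e₁.trans e⟩⟩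

end GIC

namespace GIC

section ext

open CategoryTheory Abelian

variable {R : Type u} [CommRing R]

/-- vanishing of Ext -/
def VE (R : Type u) [CommRing R] (M V : Type u) [AddCommGroup M] [Module R M] [AddCommGroup V]
    [Module R V] (i : ℕ) : Prop :=
  ∀ e : Abelian.Ext.{u} (ModuleCat.of R M) (ModuleCat.of R V) i, e = 0

variable {A B C V M : Type u} [AddCommGroup A] [Module R A] [AddCommGroup B] [Module R B]
  [AddCommGroup C] [Module R C] [AddCommGroup V] [Module R V] [AddCommGroup M] [Module R M]

theorem VE.of_old (i : ℕ) (h : Limits.IsZero (((_root_.Ext R (ModuleCat.{u} R) (i + 1)).obj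
        (Opposite.op (ModuleCat.of R M))).obj (ModuleCat.of R V))) : VE R M V (i + 1) := by
  intro e
  let P := projectiveResolution (ModuleCat.of R M)
  obtain ⟨f, hf, rfl⟩ := P.extMk_surjective e (i + 2) rfl
  rw [P.extMk_eq_zero_iff f (i + 2) rfl hf i rfl]
  have h1 := h.of_iso (P.isoExt (R := R) (i + 1) (ModuleCat.of R V)).symm
  have h2 : (P.complex.linearYonedaObj R (ModuleCat.of R V)).ExactAt (i + 1) := by
    rw [HomologicalComplex.exactAt_iff_isZero_homology]; exact h1
  rw [HomologicalComplex.exactAt_iff' _ i (i + 1) (i + 2) (by simp) (by simp)] at h2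
  rw [ShortComplex.moduleCat_exact_iff] at h2
  obtain ⟨g, hg⟩ := h2 f hf
  exact ⟨g, hg⟩

theorem SES {i : A →ₗ[R] B} {p : B →ₗ[R] C} (hi : Function.Injective i)
    (hp : Function.Surjective p) (he : Function.Exact i p) :
    (ModuleCat.shortComplexOfCompEqZero i p he.linearMap_comp_eq_zero).ShortExact :=
  ModuleCat.shortComplex_shortExact _ he hi hp

variable {i : A →ₗ[R] B} {p : B →ₗ[R] C}

theorem VE.s1 (hi : Function.Injective i)
    (hp : Function.Surjective p) (he : Function.Exact i p) {n : ℕ} (hB : VE R B V n)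
    (hC : VE R C V (n + 1)) : VE R A V n := by
  intro e
  obtain ⟨x, hx⟩ := Ext.contravariant_sequence_exact₁ (SES hi hp he) (ModuleCat.of R V) e
    (n₁ := n + 1) (by omega) (hC _)
  rw [← hx]
  have : x = 0 := hB x
  rw [this, Ext.comp_zero]

theorem VE.s2 (hi : Function.Injective i)
    (hp : Function.Surjective p) (he : Function.Exact i p) {n : ℕ} (hA : VE R A V n)
    (hB : VE R B V (n + 1)) : VE R C V (n + 1) := by
  intro e
  obtain ⟨x, hx⟩ := Ext.contravariant_sequence_exact₃ (SES hi hp he) (ModuleCat.of R V) e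
    (hB _) (n₀ := n) (by omega)
  rw [← hx]
  have : x = 0 := hA x
  rw [this, Ext.comp_zero]

theorem VE.t1 (hi : Function.Injective i)
    (hp : Function.Surjective p) (he : Function.Exact i p) {n : ℕ} (hB : VE R M B (n + 1))
    (hC : VE R M C n) : VE R M A (n + 1) := by
  intro e
  obtain ⟨x, hx⟩ := Ext.covariant_sequence_exact₁ (ModuleCat.of R M) (SES hi hp he) e
    (hB _) (n₀ := n) rfl
  rw [← hx]
  have : x = 0 := hC x
  rw [this, Ext.zero_comp]

theorem VE.t3 (hi : Function.Injective i)
    (hp : Function.Surjective p) (he : Function.Exact i p) {n : ℕ} (hB : VE R M B n)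
    (hA : VE R M A (n + 1)) : VE R M C n := by
  intro e
  obtain ⟨x, hx⟩ := Ext.covariant_sequence_exact₃ (ModuleCat.of R M) (SES hi hp he) e
    (n₁ := n + 1) rfl (hA _)
  rw [← hx]
  have : x = 0 := hB x
  rw [this, Ext.zero_comp]

theorem VE.ext (hi : Function.Injective i)
    (hp : Function.Surjective p) (he : Function.Exact i p) (hC : VE R C V 1) (f : A →ₗ[R] V) :
    ∃ g : B →ₗ[R] V, g.comp i = f := by
  obtain ⟨x, hx⟩ := Ext.contravariant_sequence_exact₁ (SES hi hp he) (ModuleCat.of R V)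
    (Ext.mk₀ (ModuleCat.ofHom f)) (n₁ := 1) rfl (hC _)
  obtain ⟨g, rfl⟩ := (Ext.mk₀_bijective _ _).2 x
  rw [Ext.mk₀_comp_mk₀] at hx
  have := (Ext.mk₀_bijective _ _).1 hx
  exact ⟨g.hom, congrArg ModuleCat.Hom.hom this⟩

theorem VE.lift (hi : Function.Injective i)
    (hp : Function.Surjective p) (he : Function.Exact i p) (hC : VE R M A 1) (f : M →ₗ[R] C) :
    ∃ g : M →ₗ[R] B, p.comp g = f := by
  obtain ⟨x, hx⟩ := Ext.covariant_sequence_exact₃ (ModuleCat.of R M) (SES hi hp he)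
    (Ext.mk₀ (ModuleCat.ofHom f)) (n₁ := 1) rfl (hC _)
  obtain ⟨g, rfl⟩ := (Ext.mk₀_bijective _ _).2 x
  rw [Ext.mk₀_comp_mk₀] at hx
  have := (Ext.mk₀_bijective _ _).1 hx
  exact ⟨g.hom, congrArg ModuleCat.Hom.hom this⟩

theorem VE.proj [Module.Projective R M] (n : ℕ) : VE R M V (n + 1) := by
  have : Projective (ModuleCat.of R M) := inferInstance
  intro e
  exact Ext.eq_zero_of_projective e

theorem VE.inj [Module.Injective R V] (n : ℕ) : VE R M V (n + 1) := by
  have : Injective (ModuleCat.of R V) := Module.injective_object_of_injective_module R V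
  intro e
  exact Ext.eq_zero_of_injective e

theorem VE.of_ext (hi : Function.Injective i)
    (hp : Function.Surjective p) (he : Function.Exact i p) (hB : VE R B V 1)
    (h : ∀ f : A →ₗ[R] V, ∃ g : B →ₗ[R] V, g.comp i = f) : VE R C V 1 := by
  intro e
  obtain ⟨x, hx⟩ := Ext.contravariant_sequence_exact₃ (SES hi hp he) (ModuleCat.of R V) e
    (hB _) (n₀ := 0) rfl
  obtain ⟨f, rfl⟩ := (Ext.mk₀_bijective _ _).2 x
  obtain ⟨g, hg⟩ := h f.hom
  have : f = (ModuleCat.shortComplexOfCompEqZero i p he.linearMap_comp_eq_zero).f ≫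
      ModuleCat.ofHom g := by
    ext1; exact hg.symm
  rw [← hx, this, ← Ext.mk₀_comp_mk₀, ← Ext.comp_assoc _ _ _ rfl (by simp) (by simp)]
  have h0 := (SES hi hp he).extClass_comp
  rw [h0, Ext.zero_comp]

end ext

end GIC

namespace GIC

section ext2

variable {R : Type u} [CommRing R]

theorem exists_free (D : Type u) [AddCommGroup D] [Module R D] :
    ∃ p : (D →₀ R) →ₗ[R] D, Function.Surjective p ∧
      Function.Exact (LinearMap.ker p).subtype p :=
  ⟨Finsupp.linearCombination R id, Finsupp.linearCombination_id_surjective R D,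
    LinearMap.exact_subtype_ker_map _⟩

theorem exists_inj (V : Type u) [AddCommGroup V] [Module R V] :
    ∃ (I : Type u) (_ : AddCommGroup I) (_ : Module R I) (_ : Module.Injective R I)
      (f : V →ₗ[R] I), Function.Injective f ∧ Function.Exact f (LinearMap.range f).mkQ := by
  obtain ⟨I, hI, f, hf⟩ := EnoughInjectives.presentation (ModuleCat.of R V)
  exact ⟨I, inferInstance, inferInstance, Module.injective_module_of_injective_object R I, f.hom,
    (ModuleCat.mono_iff_injective f).mp hf, f.hom.exact_map_mkQ_range⟩

theorem finsupp_exact (X : Type u) {A B C : Type u} [AddCommGroup A] [Module R A]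
    [AddCommGroup B] [Module R B] [AddCommGroup C] [Module R C]
    {i : A →ₗ[R] B} {p : B →ₗ[R] C} (hi : Function.Injective i)
    (hp : Function.Surjective p) (he : Function.Exact i p) :
    Function.Injective (Finsupp.mapRange.linearMap i : (X →₀ A) →ₗ[R] (X →₀ B)) ∧
    Function.Surjective (Finsupp.mapRange.linearMap p : (X →₀ B) →ₗ[R] (X →₀ C)) ∧
    Function.Exact (Finsupp.mapRange.linearMap i : (X →₀ A) →ₗ[R] (X →₀ B))
      (Finsupp.mapRange.linearMap p : (X →₀ B) →ₗ[R] (X →₀ C)) := by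
  refine ⟨Finsupp.mapRange_injective _ (map_zero i) hi,
    Finsupp.mapRange_surjective _ (map_zero p) hp, ?_⟩
  rw [LinearMap.exact_iff, Finsupp.ker_mapRange, Finsupp.range_mapRange_linearMap _
    (LinearMap.ker_eq_bot.2 hi), LinearMap.exact_iff.1 he]

theorem VE.finsupp (X : Type u) {V : Type u} [AddCommGroup V] [Module R V] (n : ℕ) :
    ∀ (D : Type u) [AddCommGroup D] [Module R D], VE R D V (n + 1) → VE R (X →₀ D) V (n + 1) := by
  induction n with
  | zero =>
    intro D _ _ h
    obtain ⟨p, hp, he⟩ := exists_free (R := R) D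
    obtain ⟨h1, h2, h3⟩ := finsupp_exact X (Submodule.subtype_injective _) hp he
    refine VE.of_ext h1 h2 h3 (VE.proj 0) fun f => ?_
    have := fun x => VE.ext (Submodule.subtype_injective _) hp he h (f.comp (Finsupp.lsingle x))
    choose g hg using this
    refine ⟨Finsupp.lsum R g, ?_⟩
    ext x k
    simpa using LinearMap.congr_fun (hg x) k
  | succ n ih =>
    intro D _ _ h
    obtain ⟨p, hp, he⟩ := exists_free (R := R) D
    obtain ⟨h1, h2, h3⟩ := finsupp_exact X (Submodule.subtype_injective _) hp he
    exact VE.s2 h1 h2 h3 (ih _ (VE.s1 (Submodule.subtype_injective _) hp he (VE.proj n) h))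
      (VE.proj (n + 1))

theorem inj_of_VE {V : Type u} [AddCommGroup V] [Module R V]
    (h : ∀ b : Ideal R, VE R (R ⧸ b) V 1) : Module.Injective R V := by
  apply Module.Baer.injective
  intro b g
  obtain ⟨g', hg'⟩ := VE.ext (Submodule.subtype_injective b) (Submodule.mkQ_surjective b)
    (LinearMap.exact_subtype_mkQ b) (h b) g
  exact ⟨g', fun x hx => LinearMap.congr_fun hg' ⟨x, hx⟩⟩

/-- injective dimension at most `k` -/
def IDL (R : Type u) [CommRing R] (k : ℕ) (V : Type u) [AddCommGroup V] [Module R V] : Prop :=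
  ∀ (M : Type u) [AddCommGroup M] [Module R M] (i : ℕ), k ≤ i → VE R M V (i + 1)

theorem IDL.test (k : ℕ) : ∀ (V : Type u) [AddCommGroup V] [Module R V],
    (∀ b : Ideal R, VE R (R ⧸ b) V (k + 1)) → IDL R k V := by
  induction k with
  | zero =>
    intro V _ _ h M _ _ i hi
    have := inj_of_VE h
    exact VE.inj i
  | succ k ih =>
    intro V _ _ h M _ _ i hi
    obtain ⟨I, _, _, hI, f, hf, he⟩ := exists_inj (R := R) V
    have h1 := ih (I ⧸ LinearMap.range f) fun b =>
      VE.t3 hf (Submodule.mkQ_surjective _) he (VE.inj k) (h b)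
    obtain ⟨j, rfl⟩ : ∃ j, i = j + 1 := ⟨i - 1, by omega⟩
    exact VE.t1 hf (Submodule.mkQ_surjective _) he (VE.inj _) (h1 M j (by omega))

theorem IDL.inj {V : Type u} [AddCommGroup V] [Module R V] (h : IDL R 0 V) :
    Module.Injective R V := inj_of_VE fun b => h _ 0 le_rfl

theorem HX.of_IDL (c : GIC R)
    (hc : ∀ (I : Type u) [AddCommGroup I] [Module R I], Module.Injective R I → c.HX I) (k : ℕ) :
    ∀ (V : Type u) [AddCommGroup V] [Module R V], IDL R k V → c.HX V := by
  induction k with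
  | zero =>
    intro V _ _ h
    exact hc V h.inj
  | succ k ih =>
    intro V _ _ h
    obtain ⟨I, _, _, hI, f, hf, he⟩ := exists_inj (R := R) V
    refine HX.sub c hf (Submodule.mkQ_surjective _) he (hc I hI) (ih _ ?_)
    intro M _ _ i hi
    exact VE.t3 hf (Submodule.mkQ_surjective _) he (VE.inj i) (h M (i + 1) (by omega))

/-- extension property -/
def EP {n : ℕ} (K : Submodule R (Fin n → R)) (A : Type u) [AddCommGroup A] [Module R A] : Prop :=
  ∀ f : K →ₗ[R] A, ∃ g : (Fin n → R) →ₗ[R] A, g.comp K.subtype = f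

theorem VE.mm [IsNoetherianRing R] {A B : Type u} [AddCommGroup A] [Module R A] [AddCommGroup B]
    [Module R B] (H : ∀ (n : ℕ) (K : Submodule R (Fin n → R)), EP K A → EP K B) (i : ℕ) :
    ∀ (M : Type u) [AddCommGroup M] [Module R M] [Module.Finite R M],
      VE R M A (i + 1) → VE R M B (i + 1) := by
  induction i with
  | zero =>
    intro M _ _ _ h
    obtain ⟨n, p, hp⟩ := Module.Finite.exists_fin' R M
    have he := LinearMap.exact_subtype_ker_map p
    have hi := Submodule.subtype_injective (LinearMap.ker p)
    exact VE.of_ext hi hp he (VE.proj 0) (H n _ (VE.ext hi hp he h))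
  | succ i ih =>
    intro M _ _ _ h
    obtain ⟨n, p, hp⟩ := Module.Finite.exists_fin' R M
    have he := LinearMap.exact_subtype_ker_map p
    have hi := Submodule.subtype_injective (LinearMap.ker p)
    exact VE.s2 hi hp he (ih _ (VE.s1 hi hp he (VE.proj i) h)) (VE.proj (i + 1))

theorem IDL.mm [IsNoetherianRing R] {A B : Type u} [AddCommGroup A] [Module R A] [AddCommGroup B]
    [Module R B] (H : ∀ (n : ℕ) (K : Submodule R (Fin n → R)), EP K A → EP K B) (k : ℕ)
    (h : IDL R k A) : IDL R k B :=
  IDL.test k B fun _ => VE.mm H k _ (h _ k le_rfl)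

end ext2

end GIC

namespace GIC

section homs

open TensorProduct

variable {R : Type u} [CommRing R]

theorem exists_pres [IsNoetherianRing R] (K : Type u) [AddCommGroup K] [Module R K]
    [Module.Finite R K] : ∃ (n m : ℕ) (β : (Fin m → R) →ₗ[R] (Fin n → R))
      (α : (Fin n → R) →ₗ[R] K), Function.Surjective α ∧ Function.Exact β α := by
  obtain ⟨n, α, hα⟩ := Module.Finite.exists_fin' R K
  obtain ⟨m, q, hq⟩ := Module.Finite.exists_fin' R (LinearMap.ker α)
  refine ⟨n, m, (LinearMap.ker α).subtype.comp q, α, hα, ?_⟩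
  rw [LinearMap.exact_iff, LinearMap.range_comp, LinearMap.range_eq_top.2 hq]
  simp

theorem homExact_left {A B C V : Type u} [AddCommGroup A] [Module R A] [AddCommGroup B]
    [Module R B] [AddCommGroup C] [Module R C] [AddCommGroup V] [Module R V]
    {β : A →ₗ[R] B} {α : B →ₗ[R] C} (hα : Function.Surjective α) (he : Function.Exact β α) :
    Function.Exact (LinearMap.lcomp R V α) (LinearMap.lcomp R V β) := by
  intro g
  constructor
  · intro h
    obtain ⟨g', hg'⟩ := fac_of_exact hα he g h
    exact ⟨g', hg'⟩
  · rintro ⟨g', rfl⟩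
    ext x
    simp [he.apply_apply_eq_zero]

theorem lcomp_inj {B C V : Type u} [AddCommGroup B]
    [Module R B] [AddCommGroup C] [Module R C] [AddCommGroup V] [Module R V]
    {α : B →ₗ[R] C} (hα : Function.Surjective α) :
    Function.Injective (LinearMap.lcomp R V α) := by
  intro f g h
  exact (LinearMap.cancel_right hα).1 h

variable {D F : Type u} [AddCommGroup D] [Module R D] [AddCommGroup F] [Module R F]

theorem rTH_nat {A B : Type u} [AddCommGroup A] [Module R A] [AddCommGroup B]
    [Module R B] (β : A →ₗ[R] B) (t : (B →ₗ[R] D) ⊗[R] F) :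
    TensorProduct.rTensorHomToHomRTensor (RingHom.id R) A D F (LinearMap.rTensor F (LinearMap.lcomp R D β) t) =
      (TensorProduct.rTensorHomToHomRTensor (RingHom.id R) B D F t).comp β := by
  induction t with
  | zero => simp
  | add x y hx hy => rw [map_add, map_add, hx, hy, map_add, LinearMap.add_comp]
  | tmul ψ x => ext a; simp

theorem rTH_bij (n : ℕ) : Function.Bijective (TensorProduct.rTensorHomToHomRTensor
      (RingHom.id R) (Fin n → R) D F) := by
  rw [← rTensorHomEquivHomRTensor_toLinearMap]
  exact (rTensorHomEquivHomRTensor R (Fin n → R) D F).bijective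

theorem rTH_surj [IsNoetherianRing R] [Module.Flat R F] (K : Type u) [AddCommGroup K] [Module R K]
    [Module.Finite R K] : Function.Surjective (TensorProduct.rTensorHomToHomRTensor
      (RingHom.id R) K D F) := by
  intro f
  obtain ⟨n, m, β, α, hα, he⟩ := exists_pres (R := R) K
  obtain ⟨t, ht⟩ := (rTH_bij n).2 (f.comp α)
  have h0 : LinearMap.rTensor F (LinearMap.lcomp R D β) t = 0 := by
    apply (rTH_bij m).1
    rw [rTH_nat, ht, map_zero, LinearMap.comp_assoc, he.linearMap_comp_eq_zero,
      LinearMap.comp_zero]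
  obtain ⟨s, rfl⟩ := (Module.Flat.rTensor_exact F (homExact_left (V := D) hα he) t).1 h0
  refine ⟨s, ?_⟩
  rw [rTH_nat] at ht
  exact (LinearMap.cancel_right hα).1 ht

theorem EP.flat [IsNoetherianRing R] [Module.Flat R F] (n : ℕ) (K : Submodule R (Fin n → R))
    (h : EP K D) : EP K (D ⊗[R] F) := by
  intro f
  obtain ⟨s, rfl⟩ := rTH_surj (R := R) K f
  have h1 : Function.Surjective (LinearMap.lcomp R D K.subtype) := h
  obtain ⟨t, rfl⟩ := LinearMap.rTensor_surjective F h1 s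
  exact ⟨_, (rTH_nat _ _).symm⟩

variable (D) (I : Type u) [AddCommGroup I] [Module R I]

/-- evaluation map -/
noncomputable def theta (K : Type u) [AddCommGroup K] [Module R K] :
    K ⊗[R] (D →ₗ[R] I) →ₗ[R] ((K →ₗ[R] D) →ₗ[R] I) :=
  TensorProduct.lift (LinearMap.mk₂ R (fun m φ => φ.comp (LinearMap.applyₗ m))
    (fun _ _ _ => by ext; simp) (fun _ _ _ => by ext; simp) (fun _ _ _ => by ext; simp)
    (fun _ _ _ => by ext; simp))

theorem theta_tmul {K : Type u} [AddCommGroup K] [Module R K] (m : K) (φ : D →ₗ[R] I)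
    (ψ : K →ₗ[R] D) : theta D I K (m ⊗ₜ φ) ψ = φ (ψ m) := by
  simp [theta]

theorem theta_nat {A B : Type u} [AddCommGroup A] [Module R A] [AddCommGroup B]
    [Module R B] (β : A →ₗ[R] B) (t : A ⊗[R] (D →ₗ[R] I)) :
    theta D I B (LinearMap.rTensor _ β t) = (theta D I A t).comp (LinearMap.lcomp R D β) := by
  induction t with
  | zero => simp
  | add x y hx hy => rw [map_add, map_add, hx, hy, map_add, LinearMap.add_comp]
  | tmul ψ x => ext a; simp [theta_tmul]

theorem exists_sum (n : ℕ) (T : Type u) [AddCommGroup T] [Module R T] (z : (Fin n → R) ⊗[R] T) :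
    ∃ φ : Fin n → T, z = ∑ j, Pi.single j (1 : R) ⊗ₜ[R] φ j := by
  induction z with
  | zero => exact ⟨0, by simp⟩
  | add x y hx hy =>
    obtain ⟨φ, rfl⟩ := hx
    obtain ⟨φ', rfl⟩ := hy
    exact ⟨φ + φ', by simp [TensorProduct.tmul_add, Finset.sum_add_distrib]⟩
  | tmul v t =>
    refine ⟨fun j => v j • t, ?_⟩
    have : v = ∑ j, v j • Pi.single j (1 : R) := by
      simpa using (pi_eq_sum_univ' v)
    conv_lhs => rw [this, TensorProduct.sum_tmul]
    simp only [TensorProduct.smul_tmul]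

theorem theta_bij_free (n : ℕ) : Function.Bijective (theta (R := R) D I (Fin n → R)) := by
  have key : ∀ (j : Fin n) (d : D), ∀ i : Fin n,
      ((LinearMap.proj j : (Fin n → R) →ₗ[R] R).smulRight d) (Pi.single i 1) =
        if i = j then d else 0 := by
    intro j d i
    by_cases h : i = j
    · subst h; simp
    · simp [h, Pi.single_apply, Ne.symm h, eq_comm]
  constructor
  · rw [injective_iff_map_eq_zero]
    intro z hz
    obtain ⟨φ, rfl⟩ := exists_sum n _ z
    have : ∀ j, φ j = 0 := by
      intro j
      ext d
      have := LinearMap.congr_fun hz ((LinearMap.proj j : (Fin n → R) →ₗ[R] R).smulRight d)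
      rw [map_sum, LinearMap.sum_apply] at this
      simp only [theta_tmul, key, apply_ite, map_zero] at this
      simpa using this
    simp [this]
  · intro h
    let φ : Fin n → (D →ₗ[R] I) := fun j =>
      { toFun := fun d => h ((LinearMap.proj j : (Fin n → R) →ₗ[R] R).smulRight d)
        map_add' := fun x y => by
          rw [← map_add]; congr 1; ext; simp
        map_smul' := fun r x => by
          rw [RingHom.id_apply, ← map_smul]; congr 1; ext; simp [smul_smul, mul_comm] }
    refine ⟨∑ j, Pi.single j (1 : R) ⊗ₜ[R] φ j, ?_⟩
    ext ψ
    rw [map_sum, LinearMap.sum_apply]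
    simp only [theta_tmul]
    change ∑ j, h _ = _
    rw [← map_sum]
    congr 1
    apply LinearMap.pi_ext'
    intro i
    ext
    simp only [LinearMap.comp_apply, LinearMap.sum_apply, LinearMap.coe_single, key]
    simp

theorem theta_bij [IsNoetherianRing R] [Module.Injective R I] (K : Type u) [AddCommGroup K]
    [Module R K] [Module.Finite R K] : Function.Bijective (theta (R := R) D I K) := by
  obtain ⟨n, m, β, α, hα, he⟩ := exists_pres (R := R) K
  have hex := homExact_left (V := D) hα he
  constructor
  · rw [injective_iff_map_eq_zero]
    intro z hz
    obtain ⟨w, rfl⟩ := LinearMap.rTensor_surjective (D →ₗ[R] I) hα z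
    rw [theta_nat] at hz
    -- theta w vanishes on range (lcomp α) = ker (lcomp β)
    have hker : LinearMap.ker (LinearMap.lcomp R D β) ≤ LinearMap.ker (theta D I _ w) := by
      intro ψ hψ
      obtain ⟨ψ', rfl⟩ := (hex ψ).1 hψ
      exact LinearMap.congr_fun hz ψ'
    have hq : Function.Injective ((LinearMap.ker (LinearMap.lcomp R D β)).liftQ
        (LinearMap.lcomp R D β) le_rfl) := by
      rw [← LinearMap.ker_eq_bot]
      exact Submodule.ker_liftQ_eq_bot _ _ _ le_rfl
    obtain ⟨h, hh⟩ := Module.Injective.extension_property R _ _ _ _ hq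
      ((LinearMap.ker (LinearMap.lcomp R D β)).liftQ _ hker)
    obtain ⟨v, hv⟩ := (theta_bij_free D I m).2 h
    have hw : LinearMap.rTensor _ β v = w := by
      apply (theta_bij_free D I n).1
      rw [theta_nat, hv]
      ext ψ
      exact LinearMap.congr_fun hh (Submodule.Quotient.mk ψ)
    rw [← hw, ← LinearMap.comp_apply, ← LinearMap.rTensor_comp, he.linearMap_comp_eq_zero]
    simp
  · intro h
    obtain ⟨h', hh'⟩ := Module.Injective.extension_property R _ _ _ _
      (lcomp_inj (V := D) hα) h
    obtain ⟨w, hw⟩ := (theta_bij_free D I n).2 h'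
    exact ⟨LinearMap.rTensor _ α w, by rw [theta_nat, hw, hh']⟩

theorem theta_equiv [IsNoetherianRing R] [Module.Injective R I] [Module.Finite R D]
    (hD : Function.Bijective (fun r : R => (r • (LinearMap.id : D →ₗ[R] D)))) :
    Nonempty (I ≃ₗ[R] D ⊗[R] (D →ₗ[R] I)) := by
  let e1 : R ≃ₗ[R] (D →ₗ[R] D) :=
    LinearEquiv.ofBijective (LinearMap.toSpanSingleton R _ LinearMap.id) hD
  let e2 := LinearEquiv.ofBijective _ (theta_bij (R := R) D I D)
  exact ⟨((LinearMap.ringLmapEquivSelf R R I).symm ≪≫ₗ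
    (e1.congrLeft I R)) ≪≫ₗ e2.symm⟩

theorem dual_inj {A B : Type u} [AddCommGroup A] [Module R A] [AddCommGroup B]
    [Module R B] (f : A →ₗ[R] B) (T : Type u) [AddCommGroup T] [Module R T]
    (h : ∀ g : T →ₗ[R] CharacterModule A,
      ∃ g' : T →ₗ[R] CharacterModule B, (CharacterModule.dual f).comp g' = g) :
    Function.Injective (LinearMap.lTensor T f) := by
  rw [← CharacterModule.dual_surjective_iff_injective]
  intro χ
  obtain ⟨g', hg'⟩ := h (CharacterModule.curry χ)
  refine ⟨CharacterModule.uncurry g', ?_⟩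
  apply (CharacterModule.homEquiv (R := R)).symm.injective
  ext t a
  exact DFunLike.congr_fun (LinearMap.congr_fun hg' t) a

theorem EP.char [IsNoetherianRing R] [Module.Injective R I] (n : ℕ) (K : Submodule R (Fin n → R))
    (h : EP K D) : EP K (CharacterModule (D →ₗ[R] I)) := by
  refine rTensor_injective_iff_lcomp_surjective.1 ?_
  rw [injective_iff_map_eq_zero]
  intro z hz
  have h0 := theta_nat D I K.subtype z
  rw [hz, map_zero] at h0
  have h1 : Function.Surjective (LinearMap.lcomp R D K.subtype) := h
  apply (theta_bij D I K).1
  rw [map_zero]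
  exact (LinearMap.cancel_right h1).1 (by rw [← h0, LinearMap.zero_comp])

end homs

end GIC

namespace GIC

section fin

open TensorProduct

variable {R : Type u} [CommRing R]

theorem dual_ses {A B C : Type u} [AddCommGroup A] [Module R A]
    [AddCommGroup B] [Module R B] [AddCommGroup C] [Module R C]
    {i : A →ₗ[R] B} {p : B →ₗ[R] C} (hp : Function.Surjective p) (he : Function.Exact i p) :
    Function.Exact (CharacterModule.dual p) (CharacterModule.dual i) := by
  intro χ
  constructor
  · intro h
    have hz : ∀ x, p x = 0 → χ x = 0 := by
      intro x hx
      obtain ⟨y, rfl⟩ := (he x).1 hx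
      exact DFunLike.congr_fun h y
    have hs := Function.surjInv_eq hp
    have hk : ∀ x y, p x = p y → χ x = χ y := by
      intro x y hxy
      rw [← sub_eq_zero, ← map_sub]
      exact hz _ (by rw [map_sub, hxy, sub_self])
    let ξ : C →+ AddCircle (1 : ℚ) := AddMonoidHom.mk' (fun z => χ (Function.surjInv hp z)) (by
      intro a b
      rw [← map_add]
      exact hk _ _ (by rw [map_add, hs, hs, hs]))
    refine ⟨ξ, ?_⟩
    apply CharacterModule.ext
    intro x
    exact hk _ _ (hs _)
  · rintro ⟨ξ, rfl⟩
    apply CharacterModule.ext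
    intro x
    change ξ (p (i x)) = 0
    rw [he.apply_apply_eq_zero, map_zero]

theorem VE.equiv {A B V : Type u} [AddCommGroup A] [Module R A] [AddCommGroup B] [Module R B]
    [AddCommGroup V] [Module R V] (e : A ≃ₗ[R] B) (n : ℕ) (h : VE R B V (n + 1)) :
    VE R A V (n + 1) := by
  have he : Function.Exact e.toLinearMap (0 : B →ₗ[R] PUnit.{u + 1}) := by
    intro x
    exact ⟨fun _ => e.surjective x, fun _ => rfl⟩
  exact VE.s1 e.injective (fun x => ⟨0, Subsingleton.elim _ _⟩) he h (VE.proj _)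

theorem char_inj (F : Type u) [AddCommGroup F] [Module R F] [Module.Flat R F] :
    Module.Injective R (CharacterModule F) :=
  Module.Flat.iff_characterModule_injective.1 inferInstance

theorem exists_free' (D : Type u) [AddCommGroup D] [Module R D] :
    ∃ (K : Type u) (_ : AddCommGroup K) (_ : Module R K) (j : K →ₗ[R] (D →₀ R))
      (p : (D →₀ R) →ₗ[R] D), Function.Injective j ∧ Function.Surjective p ∧
      Function.Exact j p := by
  obtain ⟨p, hp, he⟩ := exists_free (R := R) D
  exact ⟨LinearMap.ker p, inferInstance, inferInstance, _, p, Submodule.subtype_injective _, hp, he⟩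

theorem flat_ker {K P F : Type u} [AddCommGroup F] [Module R F] [Module.Flat R F]
    [AddCommGroup K] [Module R K] [AddCommGroup P] [Module R P] [Module.Flat R P]
    {j : K →ₗ[R] P} {p : P →ₗ[R] F} (hj : Function.Injective j) (hp : Function.Surjective p)
    (he : Function.Exact j p) : Module.Flat R K := by
  have := char_inj (R := R) F
  have := char_inj (R := R) P
  rw [Module.Flat.iff_characterModule_injective]
  exact inj_of_VE fun b => VE.t3 (CharacterModule.dual_injective_of_surjective p hp)
    (CharacterModule.dual_surjective_of_injective j hj)
    (dual_ses hp he) (VE.inj 0) (VE.inj 1)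

theorem tensor_inj {D K P T : Type u} [AddCommGroup D] [Module R D] [AddCommGroup T] [Module R T]
    [AddCommGroup K] [Module R K] [AddCommGroup P] [Module R P]
    {j : K →ₗ[R] P} {p : P →ₗ[R] T} (hj : Function.Injective j) (hp : Function.Surjective p)
    (he : Function.Exact j p) (h : VE R D (CharacterModule T) 1) :
    Function.Injective (LinearMap.lTensor D j) :=
  dual_inj _ _ fun g => VE.lift (CharacterModule.dual_injective_of_surjective p hp)
    (CharacterModule.dual_surjective_of_injective j hj)
    (dual_ses hp he) h g

variable {D : Type u} [AddCommGroup D] [Module R D] [Module.Finite R D] [IsNoetherianRing R]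
  (c : GIC R)

theorem HX.flat_aux (hDD : ∀ i, VE R D D (i + 1)) (hD : c.HX D) (m : ℕ) :
    ∀ (F : Type u) [AddCommGroup F] [Module R F] [Module.Flat R F],
    (∀ (G : Type u) [AddCommGroup G] [Module R G] [Module.Flat R G] (i : ℕ), m ≤ i →
      VE R (D ⊗[R] F) (D ⊗[R] G) (i + 1)) → c.HX (D ⊗[R] F) := by
  induction m with
  | zero =>
    intro F _ _ _ h
    classical
    obtain ⟨K, _, _, j, p, hj, hp, he⟩ := exists_free' (R := R) F
    have := char_inj (R := R) F
    have hi := tensor_inj (D := D) hj hp he (VE.inj 0)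
    have := flat_ker hj hp he
    obtain ⟨s, hs⟩ := VE.lift hi (LinearMap.lTensor_surjective D hp) (lTensor_exact D he hp)
      (h K 0 le_rfl) LinearMap.id
    exact HX.retract c s _ hs (HX.equiv c (TensorProduct.finsuppScalarRight R R D F)
      (HX.finsupp c F hD))
  | succ m ih =>
    intro F _ _ _ h
    classical
    obtain ⟨K, _, _, j, p, hj, hp, he⟩ := exists_free' (R := R) F
    have := char_inj (R := R) F
    have hi := tensor_inj (D := D) hj hp he (VE.inj 0)
    have := flat_ker hj hp he
    refine HX.quot c hi (LinearMap.lTensor_surjective D hp) (lTensor_exact D he hp)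
      (ih _ ?_) (HX.equiv c (TensorProduct.finsuppScalarRight R R D F) (HX.finsupp c F hD))
    intro G _ _ _ i hmi
    refine VE.s1 hi (LinearMap.lTensor_surjective D hp) (lTensor_exact D he hp) ?_
      (h G (i + 1) (by omega))
    exact VE.equiv (TensorProduct.finsuppScalarRight R R D F) i
      (VE.finsupp F i D (VE.mm (EP.flat (D := D) (F := G)) i D (hDD i)))

theorem HX.flat (hDD : ∀ i, VE R D D (i + 1)) {k : ℕ} (hid : IDL R k D) (hD : c.HX D)
    (F : Type u) [AddCommGroup F] [Module R F] [Module.Flat R F] : c.HX (D ⊗[R] F) :=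
  HX.flat_aux c hDD hD k F fun G _ _ _ i hi =>
    IDL.mm (EP.flat (D := D) (F := G)) k hid _ i hi

theorem HX.tensor (hDD : ∀ i, VE R D D (i + 1)) {k : ℕ} (hid : IDL R k D) (hD : c.HX D) (m : ℕ) :
    ∀ (T : Type u) [AddCommGroup T] [Module R T], (∀ i, VE R D (CharacterModule T) (i + 1)) →
      IDL R m (CharacterModule T) → c.HX (D ⊗[R] T) := by
  induction m with
  | zero =>
    intro T _ _ h1 h2
    have : Module.Flat R T := Module.Flat.iff_characterModule_injective.2 h2.inj
    exact HX.flat c hDD hid hD T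
  | succ m ih =>
    intro T _ _ h1 h2
    classical
    obtain ⟨K, _, _, j, p, hj, hp, he⟩ := exists_free' (R := R) T
    have hi := tensor_inj (D := D) hj hp he (h1 0)
    have := char_inj (R := R) (T →₀ R)
    have d1 := CharacterModule.dual_injective_of_surjective p hp
    have d2 := CharacterModule.dual_surjective_of_injective j hj
    have d3 := dual_ses hp he
    refine HX.quot c hi (LinearMap.lTensor_surjective D hp) (lTensor_exact D he hp)
      (ih _ ?_ ?_) (HX.equiv c (TensorProduct.finsuppScalarRight R R D T) (HX.finsupp c T hD))
    · intro i
      exact VE.t3 d1 d2 d3 (VE.inj i) (h1 (i + 1))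
    · intro M _ _ i hmi
      exact VE.t3 d1 d2 d3 (VE.inj i) (h2 M (i + 1) (by omega))

theorem HX.all (hDD : ∀ i, VE R D D (i + 1)) {k : ℕ} (hid : IDL R k D) (hD : c.HX D)
    (hb : Function.Bijective (fun r : R => (r • (LinearMap.id : D →ₗ[R] D))))
    (I : Type u) [AddCommGroup I] [Module R I] [Module.Injective R I] : c.HX I := by
  obtain ⟨e⟩ := theta_equiv D I hb
  refine HX.equiv c e (HX.tensor c hDD hid hD k _ ?_ ?_)
  · intro i
    exact VE.mm (EP.char D I) i D (hDD i)
  · exact IDL.mm (EP.char D I) k hid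

end fin

end GIC

/-- over a noetherian ring with a dualizing module, the `a`-torsion
submodule of a Gorenstein injective module is Gorenstein injective. -/
theorem isGorensteinInjective_torsionGamma
    {R : Type u} [CommRing R] [IsNoetherianRing R]
    (D : Type u) [AddCommGroup D] [Module R D] (hD : IsDualizingModule R D)
    (a : Ideal R) (G : Type u) [AddCommGroup G] [Module R G]
    (hG : IsGorensteinInjective R G) :
    IsGorensteinInjective R (torsionGamma a G) := by
  obtain ⟨hfin, ⟨k, hk⟩, hb, he⟩ := hD
  have hDD : ∀ i, GIC.VE R D D (i + 1) := fun i => GIC.VE.of_old i (he (i + 1) (by omega))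
  have hid : GIC.IDL R k D := fun M _ _ i hi =>
    GIC.VE.of_old i (hk M inferInstance inferInstance (i + 1) (by omega))
  obtain ⟨g⟩ := hG
  let c : GIC R :=
    { E := g.E, acg := g.acg, mod := g.mod, d := g.d, inj := g.inj, exact := g.exact }
  have hc : ∀ (I : Type u) [AddCommGroup I] [Module R I], Module.Injective R I → c.HX I :=
    fun I _ _ hI i f hf => (g.homExact I hI i f).1 hf
  have hw : GIC.Weak (R := R) D G := ⟨c, GIC.HX.of_IDL c hc k D hid, ⟨g.equiv⟩⟩
  obtain ⟨c', hc', ⟨e⟩⟩ := GIC.Weak.gam a hw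
  refine ⟨{ E := c'.E, acg := c'.acg, mod := c'.mod, d := c'.d, inj := c'.inj, exact := c'.exact,
            homExact := ?_, equiv := e }⟩
  intro I _ _ hI i f
  constructor
  · exact GIC.HX.all c' hDD hid hc' hb I i f
  · rintro ⟨f', rfl⟩
    rw [← LinearMap.comp_assoc, c'.ddc, LinearMap.zero_comp]
end

section
/- Let R be a commutative noetherian ring with a dualizing module D, let p be a prime ideal of R of height h, and let G be a Gorenstein injective R-module. Then Tor_i^R(E(R/p), Hom_R(D,G)) = 0 for all i ≠ h. -/
open CategoryTheory

universe u

section PartA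
variable {R : Type u} [CommRing R]

lemma ext_vanish_of_old (M D : Type u) [AddCommGroup M] [Module R M] [AddCommGroup D] [Module R D]
    (i : ℕ) (hi : 0 < i)
    (H : Limits.IsZero (((Ext R (ModuleCat.{u} R) i).obj
        (Opposite.op (ModuleCat.of R M))).obj (ModuleCat.of R D))) :
    ∀ e : Abelian.Ext (ModuleCat.of R M) (ModuleCat.of R D) i, e = 0 := by
  intro e
  let P := projectiveResolution (ModuleCat.of R M)
  have H2 := H.of_iso (P.isoExt (R := R) i (ModuleCat.of R D)).symm
  rw [← HomologicalComplex.exactAt_iff_isZero_homology] at H2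
  obtain ⟨j, rfl⟩ : ∃ j, i = j + 1 := ⟨i - 1, by omega⟩
  rw [HomologicalComplex.exactAt_iff' _ j (j+1) (j+2) (by simp) (by simp),
    ShortComplex.moduleCat_exact_iff] at H2
  obtain ⟨f, hf, rfl⟩ := P.extMk_surjective e (j + 2) rfl
  rw [P.extMk_eq_zero_iff f (j+2) rfl hf j rfl]
  obtain ⟨g, hg⟩ := H2 f hf
  exact ⟨g, hg⟩

/-- `J` separates points of all modules. -/
def Cogen (R : Type u) [CommRing R] (J : Type u) [AddCommGroup J] [Module R J] : Prop :=
  ∀ (M : Type u) [AddCommGroup M] [Module R M] (m : M), (∀ f : M →ₗ[R] J, f m = 0) → m = 0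

lemma charModule_inj : Module.Injective R (CharacterModule R) :=
  Module.Flat.iff_characterModule_injective.1 inferInstance

lemma charModule_sep : Cogen R (CharacterModule R) := by
  intro M _ _ m hm
  apply CharacterModule.eq_zero_of_character_apply
  intro c
  let f : M →ₗ[R] CharacterModule R :=
    { toFun := fun x => (c : M →+ _).comp ((LinearMap.toSpanSingleton R M x).toAddMonoidHom)
      map_add' := fun x y => by
        ext r
        change c (r • (x + y)) = c (r • x) + c (r • y)
        simp
      map_smul' := fun a x => by
        ext r
        change c (r • (a • x)) = c ((a * r) • x)
        rw [smul_smul, mul_comm] }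
  have h1 : (f m) (1 : R) = 0 := by rw [hm f]; rfl
  have h2 : (f m) (1:R) = c ((1:R) • m) := rfl
  rw [← h1, h2, one_smul]

variable {J : Type u} [AddCommGroup J] [Module R J]

lemma Cogen.mem (hJ : Cogen R J) {M : Type u} [AddCommGroup M] [Module R M] (N : Submodule R M) (m : M)
    (hm : ∀ f : M →ₗ[R] J, (∀ x ∈ N, f x = 0) → f m = 0) : m ∈ N := by
  rw [← Submodule.Quotient.mk_eq_zero]
  apply hJ
  intro f
  exact hm (f.comp N.mkQ) (fun x hx => by simp [(Submodule.Quotient.mk_eq_zero N).2 hx])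

open TensorProduct in
lemma tor_vanish_of_ext (hJ : Cogen R J) (X M : Type u) [AddCommGroup X] [Module R X] [AddCommGroup M] [Module R M]
    (i : ℕ)
    (H : ∀ e : Abelian.Ext (ModuleCat.of R M) (ModuleCat.of R (X →ₗ[R] J)) i, e = 0) :
    Limits.IsZero (((Tor (ModuleCat.{u} R) i).obj (ModuleCat.of R X)).obj (ModuleCat.of R M)) := by
  let P := projectiveResolution (ModuleCat.of R M)
  refine Limits.IsZero.of_iso ?_ (P.isoLeftDerivedObj _ i)
  change Limits.IsZero (HomologicalComplex.homology _ i)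
  rw [← HomologicalComplex.exactAt_iff_isZero_homology]
  have key : ∀ c : X ⊗[R] (P.complex.X i) →ₗ[R] J,
      (∀ x, c (LinearMap.lTensor X (P.complex.d (i+1) i).hom x) = 0) →
      (P.complex.d (i+1) i) ≫ ModuleCat.ofHom (Y := (X →ₗ[R] J)) (TensorProduct.curry (c.comp (TensorProduct.comm R _ _).toLinearMap)) = 0 := by
    intro c hc
    ext a x
    exact hc (x ⊗ₜ a)
  rcases i with _ | j
  · rw [HomologicalComplex.exactAt_iff' _ 1 0 0 (by simp) (by simp),
      ShortComplex.moduleCat_exact_iff]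
    intro z hz
    change X ⊗[R] (P.complex.X 0) at z
    change z ∈ LinearMap.range (LinearMap.lTensor X (P.complex.d 1 0).hom)
    apply hJ.mem
    intro c hc
    have h1 := key c (fun x => hc _ ⟨x, rfl⟩)
    let g : ModuleCat.of R M ⟶ _ := P.exact₀.desc _ h1
    have hg : P.π.f 0 ≫ g = _ := P.exact₀.g_desc _ h1
    have hg0 : g = 0 := Abelian.Ext.addEquiv₀.symm.injective ((H _).trans (H _).symm)
    have : c = 0 := by
      ext x a
      have := congrArg (fun q => (q.hom a : X →ₗ[R] J) x) hg
      refine this.symm.trans ?_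
      change (g.hom ((P.π.f 0).hom a) : X →ₗ[R] J) x = 0
      rw [hg0]; rfl
    rw [this]; rfl
  · rw [HomologicalComplex.exactAt_iff' _ (j+2) (j+1) j (by simp) (by simp),
      ShortComplex.moduleCat_exact_iff]
    intro z hz
    change X ⊗[R] (P.complex.X (j+1)) at z
    change z ∈ LinearMap.range (LinearMap.lTensor X (P.complex.d (j+2) (j+1)).hom)
    change LinearMap.lTensor X (P.complex.d (j+1) j).hom z = 0 at hz
    apply hJ.mem
    intro c hc
    have h1 := key c (fun x => hc _ ⟨x, rfl⟩)
    obtain ⟨g, hg⟩ := (P.extMk_eq_zero_iff _ (j+2) rfl h1 j rfl).1 (H _)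
    let g' : X ⊗[R] (P.complex.X j) →ₗ[R] J := (TensorProduct.lift g.hom).comp (TensorProduct.comm R _ _).toLinearMap
    have : c = g'.comp (LinearMap.lTensor X (P.complex.d (j+1) j).hom) := by
      ext x a
      have := congrArg (fun q => (q.hom a : X →ₗ[R] J) x) hg
      exact this.symm
    rw [this, LinearMap.comp_apply, hz, map_zero]
end PartA


section PartB
variable {R : Type u} [CommRing R]

/-- `s` kills `Ext^i(X,Y)`. -/
def Kil (s : R) (i : ℕ) (X Y : Type u) [AddCommGroup X] [Module R X] [AddCommGroup Y] [Module R Y] :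
    Prop :=
  ∀ e : Abelian.Ext (ModuleCat.of R X) (ModuleCat.of R Y) i, s • e = 0

variable {A B C X Y : Type u} [AddCommGroup A] [Module R A] [AddCommGroup B] [Module R B]
  [AddCommGroup C] [Module R C] [AddCommGroup X] [Module R X] [AddCommGroup Y] [Module R Y]

/-- A short exact sequence of modules (in one Prop). -/
structure SES (f : A →ₗ[R] B) (g : B →ₗ[R] C) : Prop where
  inj : Function.Injective f
  exact : Function.Exact f g
  surj : Function.Surjective g

/-- the short complex -/
abbrev SES.S {f : A →ₗ[R] B} {g : B →ₗ[R] C} (h : SES f g) : ShortComplex (ModuleCat.{u} R) :=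
  ShortComplex.mk (ModuleCat.ofHom f) (ModuleCat.ofHom g) (by
    ext x; exact h.exact.apply_apply_eq_zero x)

lemma SES.se {f : A →ₗ[R] B} {g : B →ₗ[R] C} (h : SES f g) : h.S.ShortExact where
  exact := (ShortComplex.ShortExact.moduleCat_exact_iff_function_exact _).2 h.exact
  mono_f := (ModuleCat.mono_iff_injective _).2 h.inj
  epi_g := (ModuleCat.epi_iff_surjective _).2 h.surj

open Abelian

lemma Kil.mul_left {s : R} {i : ℕ} (h : Kil s i X Y) (t : R) : Kil (t * s) i X Y := by
  intro e; rw [mul_smul, h, smul_zero]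

lemma Kil.mul_right {s : R} {i : ℕ} (h : Kil s i X Y) (t : R) : Kil (s * t) i X Y := by
  rw [mul_comm]; exact h.mul_left t

lemma Kil.of_one {i : ℕ} (h : Kil (1:R) i X Y) (t : R) : Kil t i X Y := by
  simpa using h.mul_left t

lemma SES.contra_mid {f : A →ₗ[R] B} {g : B →ₗ[R] C} (h : SES f g) {s t : R} {i : ℕ}
    (h1 : Kil s i A Y) (h2 : Kil t i C Y) : Kil (t * s) i B Y := by
  intro e
  obtain ⟨y, hy⟩ := Ext.contravariant_sequence_exact₂ h.se _ (s • e) (by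
    rw [Ext.comp_smul]; exact h1 _)
  rw [mul_smul, ← hy, ← Ext.comp_smul, show t • y = 0 from h2 y, Ext.comp_zero]

lemma SES.contra_left {f : A →ₗ[R] B} {g : B →ₗ[R] C} (h : SES f g) {s t : R} {i : ℕ}
    (h1 : Kil s i B Y) (h2 : Kil t (i+1) C Y) : Kil (s * t) i A Y := by
  intro e
  obtain ⟨y, hy⟩ := Ext.contravariant_sequence_exact₁ h.se _ (t • e) (add_comm 1 i) (by
    rw [Ext.comp_smul]; exact h2 _)
  rw [mul_smul, ← hy, ← Ext.comp_smul, show s • y = 0 from h1 y, Ext.comp_zero]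

lemma SES.contra_right {f : A →ₗ[R] B} {g : B →ₗ[R] C} (h : SES f g) {s t : R} {i : ℕ}
    (h1 : Kil s i A Y) (h2 : Kil t (i+1) B Y) : Kil (s * t) (i+1) C Y := by
  intro e
  obtain ⟨y, hy⟩ := Ext.contravariant_sequence_exact₃ h.se _ (t • e) (by
    rw [Ext.comp_smul]; exact h2 _) (add_comm 1 i)
  rw [mul_smul, ← hy, ← Ext.comp_smul, show s • y = 0 from h1 y, Ext.comp_zero]

lemma SES.cov_mid {f : A →ₗ[R] B} {g : B →ₗ[R] C} (h : SES f g) {s t : R} {i : ℕ}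
    (h1 : Kil s i X A) (h2 : Kil t i X C) : Kil (s * t) i X B := by
  intro e
  obtain ⟨y, hy⟩ := Ext.covariant_sequence_exact₂ _ h.se (t • e) (by
    rw [Ext.smul_comp]; exact h2 _)
  rw [mul_smul, ← hy, ← Ext.smul_comp, show s • y = 0 from h1 y, Ext.zero_comp]

lemma SES.cov_right {f : A →ₗ[R] B} {g : B →ₗ[R] C} (h : SES f g) {s t : R} {i : ℕ}
    (h1 : Kil s i X B) (h2 : Kil t (i+1) X A) : Kil (s * t) i X C := by
  intro e
  obtain ⟨y, hy⟩ := Ext.covariant_sequence_exact₃ _ h.se (t • e) rfl (by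
    rw [Ext.smul_comp]; exact h2 _)
  rw [mul_smul, ← hy, ← Ext.smul_comp, show s • y = 0 from h1 y, Ext.zero_comp]

lemma SES.cov_left {f : A →ₗ[R] B} {g : B →ₗ[R] C} (h : SES f g) {s t : R} {i : ℕ}
    (h1 : Kil s i X C) (h2 : Kil t (i+1) X B) : Kil (s * t) (i+1) X A := by
  intro e
  obtain ⟨y, hy⟩ := Ext.covariant_sequence_exact₁ _ h.se (t • e) (by
    rw [Ext.smul_comp]; exact h2 _) rfl
  rw [mul_smul, ← hy, ← Ext.smul_comp, show s • y = 0 from h1 y, Ext.zero_comp]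

lemma kil_zero_iff {s : R} : Kil s 0 X Y ↔ ∀ f : X →ₗ[R] Y, s • f = 0 := by
  constructor
  · intro h f
    have h1 := h (Ext.mk₀ (ModuleCat.ofHom f))
    rw [← Ext.mk₀_smul] at h1
    have h2 : s • ModuleCat.ofHom f = 0 := Ext.addEquiv₀.symm.injective (h1.trans (by exact (Ext.mk₀_zero _ _).symm))
    exact congrArg ModuleCat.Hom.hom h2
  · intro h e
    obtain ⟨f, rfl⟩ := Ext.addEquiv₀.symm.surjective e
    have : s • f = 0 := by
      ext x; exact congrArg (fun q => q x) (h f.hom)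
    change s • Ext.mk₀ f = 0
    rw [← Ext.mk₀_smul, this, Ext.mk₀_zero]

lemma kil_of_projective [Module.Projective R X] (i : ℕ) (s : R) : Kil s (i+1) X Y := by
  have : Projective (ModuleCat.of R X) := (IsProjective.iff_projective X).1 inferInstance
  intro e
  rw [Ext.eq_zero_of_projective e, smul_zero]

lemma kil_of_injective (h : Module.Injective R Y) (i : ℕ) (s : R) : Kil s (i+1) X Y := by
  have : Injective (ModuleCat.of R Y) := (Module.injective_iff_injective_object R Y).1 h
  intro e
  rw [Ext.eq_zero_of_injective e, smul_zero]

lemma kil_of_smul_left {s : R} (h : ∀ x : X, s • x = 0) (i : ℕ) : Kil s i X Y := by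
  intro e
  have h1 : s • 𝟙 (ModuleCat.of R X) = 0 := by ext x; exact h x
  have : s • e = (Ext.mk₀ (s • 𝟙 (ModuleCat.of R X))).comp e (zero_add i) := by simp [Ext.mk₀_smul]
  rw [this, h1]; simp

lemma kil_of_smul_right {s : R} (h : ∀ x : Y, s • x = 0) (i : ℕ) : Kil s i X Y := by
  intro e
  have h1 : s • 𝟙 (ModuleCat.of R Y) = 0 := by ext x; exact h x
  rw [Ext.smul_eq_comp_mk₀, h1]; simp

lemma Kil.congr_left {s : R} {i : ℕ} (h : Kil s i X Y) (e : X ≃ₗ[R] A) : Kil s i A Y := by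
  intro x
  have h1 := h ((Ext.mk₀ (ModuleCat.ofHom e.toLinearMap)).comp x (zero_add i))
  have h2 : (Ext.mk₀ (ModuleCat.ofHom e.symm.toLinearMap)).comp
      ((Ext.mk₀ (ModuleCat.ofHom e.toLinearMap)).comp x (zero_add i)) (zero_add i) = x := by
    rw [Ext.mk₀_comp_mk₀_assoc]
    have : ModuleCat.ofHom e.symm.toLinearMap ≫ ModuleCat.ofHom e.toLinearMap
      = 𝟙 (ModuleCat.of R A) := by ext x; simp
    rw [this]; simp
  rw [← h2, ← Ext.comp_smul, h1, Ext.comp_zero]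

lemma Kil.congr_right {s : R} {i : ℕ} (h : Kil s i X Y) (e : Y ≃ₗ[R] A) : Kil s i X A := by
  intro x
  have h1 := h (x.comp (Ext.mk₀ (ModuleCat.ofHom e.symm.toLinearMap)) (add_zero i))
  have h2 : (x.comp (Ext.mk₀ (ModuleCat.ofHom e.symm.toLinearMap)) (add_zero i)).comp
      (Ext.mk₀ (ModuleCat.ofHom e.toLinearMap)) (add_zero i) = x := by
    rw [Ext.comp_assoc_of_third_deg_zero, Ext.mk₀_comp_mk₀]
    have : ModuleCat.ofHom e.symm.toLinearMap ≫ ModuleCat.ofHom e.toLinearMap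
      = 𝟙 (ModuleCat.of R A) := by ext x; simp
    rw [this]; simp
  rw [← h2, ← Ext.smul_comp, h1, Ext.zero_comp]

/-- Ext^1 via a projective presentation. -/
lemma SES.kil_one_iff_contra {f : A →ₗ[R] B} {g : B →ₗ[R] C} (h : SES f g) {s : R}
    (hB : Kil (1:R) 1 B Y) :
    Kil s 1 C Y ↔ ∀ φ : A →ₗ[R] Y, ∃ ψ : B →ₗ[R] Y, ψ.comp f = s • φ := by
  constructor
  · intro hs φ
    obtain ⟨y, hy⟩ := Ext.contravariant_sequence_exact₁ h.se (ModuleCat.of R Y)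
      (Ext.mk₀ (s • ModuleCat.ofHom φ)) (rfl : 1 + 0 = 1) (by
      rw [Ext.mk₀_smul, Ext.comp_smul]; exact hs _)
    obtain ⟨ψ, rfl⟩ := Ext.addEquiv₀.symm.surjective y
    change (Ext.mk₀ _).comp (Ext.mk₀ ψ) _ = _ at hy
    rw [Ext.mk₀_comp_mk₀] at hy
    have h2 := Ext.addEquiv₀.symm.injective hy
    exact ⟨ψ.hom, congrArg ModuleCat.Hom.hom h2⟩
  · intro hs e
    obtain ⟨y, rfl⟩ := Ext.contravariant_sequence_exact₃ h.se _ e (by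
      have := hB ((Ext.mk₀ h.S.g).comp e (zero_add 1)); rwa [one_smul] at this) (rfl : 1 + 0 = 1)
    obtain ⟨φ, rfl⟩ := Ext.addEquiv₀.symm.surjective y
    change s • h.se.extClass.comp (Ext.mk₀ φ) _ = 0
    obtain ⟨ψ, hψ⟩ := hs φ.hom
    have : s • φ = h.S.f ≫ ModuleCat.ofHom ψ := by
      ext x; exact (congrArg (fun q => q x) hψ).symm
    rw [← Ext.comp_smul, ← Ext.mk₀_smul, this, ← Ext.mk₀_comp_mk₀]
    exact h.se.extClass_comp_assoc _

lemma SES.kil_one_iff_cov {f : A →ₗ[R] B} {g : B →ₗ[R] C} (h : SES f g) {s : R}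
    (hB : Kil (1:R) 1 X B) :
    Kil s 1 X A ↔ ∀ φ : X →ₗ[R] C, ∃ ψ : X →ₗ[R] B, g.comp ψ = s • φ := by
  constructor
  · intro hs φ
    obtain ⟨y, hy⟩ := Ext.covariant_sequence_exact₃ (ModuleCat.of R X) h.se
      (Ext.mk₀ (s • ModuleCat.ofHom φ)) (rfl : 0 + 1 = 1) (by
      rw [Ext.mk₀_smul, Ext.smul_comp]; exact hs _)
    obtain ⟨ψ, rfl⟩ := Ext.addEquiv₀.symm.surjective y
    change (Ext.mk₀ ψ).comp (Ext.mk₀ _) _ = _ at hy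
    rw [Ext.mk₀_comp_mk₀] at hy
    have h2 := Ext.addEquiv₀.symm.injective hy
    exact ⟨ψ.hom, congrArg ModuleCat.Hom.hom h2⟩
  · intro hs e
    obtain ⟨y, rfl⟩ := Ext.covariant_sequence_exact₁ _ h.se e (by
      have := hB (e.comp (Ext.mk₀ h.S.f) (add_zero 1)); rwa [one_smul] at this) (rfl : 0 + 1 = 1)
    obtain ⟨φ, rfl⟩ := Ext.addEquiv₀.symm.surjective y
    change s • (Ext.mk₀ φ).comp h.se.extClass _ = 0
    obtain ⟨ψ, hψ⟩ := hs φ.hom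
    have : s • φ = ModuleCat.ofHom ψ ≫ h.S.g := by
      ext x; exact (congrArg (fun q => q x) hψ).symm
    rw [← Ext.smul_comp, ← Ext.mk₀_smul, this, ← Ext.mk₀_comp_mk₀]
    have h3 : (Ext.mk₀ h.S.g).comp h.se.extClass (zero_add 1) = 0 := h.se.comp_extClass
    rw [Ext.comp_assoc_of_second_deg_zero]
    exact (congrArg (fun q => (Ext.mk₀ (ModuleCat.ofHom ψ)).comp q (zero_add 1)) h3).trans
      (Ext.comp_zero _ _ _ _ _)

lemma ses_ker (g : B →ₗ[R] C) (hg : Function.Surjective g) : SES (LinearMap.ker g).subtype g :=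
  ⟨Subtype.val_injective, LinearMap.exact_subtype_ker_map g, hg⟩

lemma ses_mkQ (N : Submodule R B) : SES N.subtype N.mkQ :=
  ⟨Subtype.val_injective, LinearMap.exact_subtype_mkQ N, N.mkQ_surjective⟩

lemma ses_coker (f : A →ₗ[R] B) (hf : Function.Injective f) : SES f (LinearMap.range f).mkQ :=
  ⟨hf, LinearMap.exact_map_mkQ_range f, Submodule.mkQ_surjective _⟩

lemma exists_inj_ses (Y : Type u) [AddCommGroup Y] [Module R Y] : ∃ (J : Type u) (_ : AddCommGroup J) (_ : Module R J) (Z : Type u)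
    (_ : AddCommGroup Z) (_ : Module R Z) (f : Y →ₗ[R] J) (g : J →ₗ[R] Z),
    Module.Injective R J ∧ SES f g := by
  obtain ⟨⟨J, hJ, f, hf⟩⟩ := EnoughInjectives.presentation (ModuleCat.of R Y)
  exact ⟨J, inferInstance, inferInstance, _, inferInstance, inferInstance, f.hom, _,
    (Module.injective_iff_injective_object R J).2 hJ,
    ses_coker f.hom ((ModuleCat.mono_iff_injective f).1 hf)⟩

lemma exists_free_ses (X : Type u) [AddCommGroup X] [Module R X] : ∃ (P : Type u) (_ : AddCommGroup P) (_ : Module R P) (K : Type u)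
    (_ : AddCommGroup K) (_ : Module R K) (f : K →ₗ[R] P) (g : P →ₗ[R] X),
    Module.Free R P ∧ SES f g :=
  ⟨X →₀ R, inferInstance, inferInstance, _, inferInstance, inferInstance, _,
    Finsupp.linearCombination R id, inferInstance, ses_ker _ (Finsupp.linearCombination_id_surjective R X)⟩

lemma exists_finite_free_ses [IsNoetherianRing R] (X : Type u) [AddCommGroup X] [Module R X] [Module.Finite R X] : ∃ (P : Type u) (_ : AddCommGroup P)
    (_ : Module R P) (K : Type u)
    (_ : AddCommGroup K) (_ : Module R K) (f : K →ₗ[R] P) (g : P →ₗ[R] X),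
    Module.Free R P ∧ Module.Finite R P ∧ Module.Finite R K ∧ SES f g := by
  obtain ⟨P, _, _, _, _, f, hf⟩ := Module.exists_finite_presentation R X
  exact ⟨P, inferInstance, inferInstance, _, inferInstance, inferInstance, _, f, inferInstance,
    inferInstance, inferInstance, ses_ker f hf⟩

end PartB


section PartC
variable {R : Type u} [CommRing R]
variable {A B C X Y : Type u} [AddCommGroup A] [Module R A] [AddCommGroup B] [Module R B]
  [AddCommGroup C] [Module R C] [AddCommGroup X] [Module R X] [AddCommGroup Y] [Module R Y]

lemma SES.contra_shift {f : A →ₗ[R] B} {g : B →ₗ[R] C} (h : SES f g) {s : R} {i : ℕ}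
    (h1 : Kil (1:R) (i+1) B Y) (h2 : Kil (1:R) (i+2) B Y) :
    Kil s (i+2) C Y ↔ Kil s (i+1) A Y :=
  ⟨fun H => by simpa using h.contra_left h1 H, fun H => by simpa using h.contra_right H h2⟩

lemma SES.cov_shift {f : A →ₗ[R] B} {g : B →ₗ[R] C} (h : SES f g) {s : R} {i : ℕ}
    (h1 : Kil (1:R) (i+1) X B) (h2 : Kil (1:R) (i+2) X B) :
    Kil s (i+2) X A ↔ Kil s (i+1) X C :=
  ⟨fun H => by simpa using h.cov_right h1 H, fun H => by simpa using h.cov_left H h2⟩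

variable {J : Type u} [AddCommGroup J] [Module R J]

lemma inj_ext (hJ : Module.Injective R J) (f : A →ₗ[R] B) (hf : Function.Injective f)
    (g : A →ₗ[R] J) : ∃ h : B →ₗ[R] J, h.comp f = g := by
  obtain ⟨h, hh⟩ := hJ.out f hf g
  exact ⟨h, LinearMap.ext hh⟩

lemma inj_ext_ex (hJ : Module.Injective R J) (f : A →ₗ[R] B) (g : B →ₗ[R] C)
    (hfg : Function.Exact f g)
    (φ : B →ₗ[R] J) (hφ : φ.comp f = 0) : ∃ ψ : C →ₗ[R] J, ψ.comp g = φ := by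
  have hle : LinearMap.ker g ≤ LinearMap.ker φ := by
    intro x hx
    obtain ⟨y, rfl⟩ := (hfg x).1 hx
    exact LinearMap.congr_fun hφ y
  obtain ⟨ψ, hψ⟩ := inj_ext hJ ((LinearMap.ker g).liftQ g le_rfl)
    (LinearMap.ker_eq_bot.1 (Submodule.ker_liftQ_eq_bot _ _ _ le_rfl))
    ((LinearMap.ker g).liftQ φ hle)
  refine ⟨ψ, ?_⟩
  ext x
  exact LinearMap.congr_fun hψ (Submodule.Quotient.mk x)

lemma SES.homJ {f : A →ₗ[R] B} {g : B →ₗ[R] C} (h : SES f g) (hJ : Module.Injective R J) :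
    SES (LinearMap.lcomp R J g) (LinearMap.lcomp R J f) where
  inj := by
    intro a b hab
    ext x
    obtain ⟨y, rfl⟩ := h.surj x
    exact LinearMap.congr_fun hab y
  exact := by
    intro φ
    constructor
    · intro hφ
      exact inj_ext_ex hJ f g h.exact φ hφ
    · rintro ⟨ψ, rfl⟩
      ext x
      change ψ (g (f x)) = 0
      rw [h.exact.apply_apply_eq_zero, map_zero]
  surj := fun φ => inj_ext hJ f h.inj φ

lemma homJ_inj (hJ : Module.Injective R J) [Module.Flat R A] : Module.Injective R (A →ₗ[R] J) := by
  refine ⟨fun X Y _ _ _ _ f hf g => ?_⟩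
  obtain ⟨ψ, hψ⟩ := inj_ext hJ (LinearMap.rTensor A f) (Module.Flat.rTensor_preserves_injective_linearMap f hf)
    (TensorProduct.lift g)
  refine ⟨TensorProduct.curry ψ, fun x => ?_⟩
  ext a
  exact LinearMap.congr_fun hψ (x ⊗ₜ a)

lemma kil_balance_aux (hJ : Module.Injective R J) (s : R) (i : ℕ) : ∀ (A B : Type u) [AddCommGroup A] [Module R A]
    [AddCommGroup B] [Module R B], Kil s i A (B →ₗ[R] J) ↔ Kil s i B (A →ₗ[R] J) := by
  match i with
  | 0 =>
    intro A B _ _ _ _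
    rw [kil_zero_iff, kil_zero_iff]
    constructor
    all_goals
      intro h f
      ext a b
      exact LinearMap.congr_fun (LinearMap.congr_fun (h f.flip) b) a
  | 1 =>
    intro A B _ _ _ _
    obtain ⟨F, _, _, K, _, _, f, g, hF, h⟩ := exists_free_ses (R := R) A
    rw [h.kil_one_iff_contra (kil_of_projective _ _),
      (h.homJ hJ).kil_one_iff_cov (kil_of_injective (homJ_inj hJ) _ _)]
    constructor
    all_goals
      intro h φ
      obtain ⟨ψ, hψ⟩ := h φ.flip
      refine ⟨ψ.flip, ?_⟩
      ext a b
      exact LinearMap.congr_fun (LinearMap.congr_fun hψ b) a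
  | i+2 =>
    intro A B _ _ _ _
    obtain ⟨F, _, _, K, _, _, f, g, hF, h⟩ := exists_free_ses (R := R) A
    rw [h.contra_shift (kil_of_projective _ _) (kil_of_projective _ _),
      (h.homJ hJ).cov_shift (kil_of_injective (homJ_inj hJ) _ _)
        (kil_of_injective (homJ_inj hJ) _ _)]
    exact kil_balance_aux hJ s (i+1) K B

lemma kil_balance (hJ : Module.Injective R J) {s : R} {i : ℕ} :
    Kil s i A (B →ₗ[R] J) ↔ Kil s i B (A →ₗ[R] J) := kil_balance_aux hJ s i A B

end PartC


section PartD
variable {R : Type u} [CommRing R]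
variable {Y Z D E J : Type u} [AddCommGroup Y] [Module R Y] [AddCommGroup Z] [Module R Z]
  [AddCommGroup D] [Module R D] [AddCommGroup E] [Module R E] [AddCommGroup J] [Module R J]

open TensorProduct

/-- `Y ⊗ Hom(D,E) → Hom(Hom(Y,D),E)`. -/
noncomputable def thetaMap (Y D E : Type u) [AddCommGroup Y] [Module R Y]
    [AddCommGroup D] [Module R D] [AddCommGroup E] [Module R E] :
    Y ⊗[R] (D →ₗ[R] E) →ₗ[R] ((Y →ₗ[R] D) →ₗ[R] E) :=
  TensorProduct.lift (LinearMap.mk₂ R (fun y h => h.comp (LinearMap.applyₗ y))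
    (by intros; ext; simp) (by intros; ext; simp) (by intros; ext; simp) (by intros; ext; simp))

@[simp] lemma thetaMap_tmul (y : Y) (h : D →ₗ[R] E) (α : Y →ₗ[R] D) :
    thetaMap Y D E (y ⊗ₜ h) α = h (α y) := rfl

lemma thetaMap_nat (f : Y →ₗ[R] Z) (z : Y ⊗[R] (D →ₗ[R] E)) (α : Z →ₗ[R] D) :
    thetaMap Z D E (LinearMap.rTensor _ f z) α = thetaMap Y D E z (α.comp f) := by
  induction z with
  | zero => simp
  | tmul y h => simp
  | add a b ha hb => simp [ha, hb]

lemma thetaMap_free [Module.Free R Y] [Module.Finite R Y] :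
    Function.Bijective (thetaMap (R := R) Y D E) := by
  classical
  let b := Module.Free.chooseBasis R Y
  let inv : ((Y →ₗ[R] D) →ₗ[R] E) → Y ⊗[R] (D →ₗ[R] E) := fun w =>
    ∑ i, b i ⊗ₜ (w.comp (LinearMap.smulRightₗ (R := R) (M₂ := Y) (M := D) (b.coord i)))
  have hadd : ∀ v w, inv (v + w) = inv v + inv w := by
    intro v w
    simp only [inv, LinearMap.add_comp, tmul_add, Finset.sum_add_distrib]
  have h1 : ∀ z, inv (thetaMap Y D E z) = z := by
    intro z
    induction z with
    | zero => simp [inv]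
    | add x y hx hy => rw [map_add, hadd, hx, hy]
    | tmul y h =>
      have : ∀ i, ((thetaMap Y D E (y ⊗ₜ h)).comp
        (LinearMap.smulRightₗ (R := R) (M₂ := Y) (M := D) (b.coord i))) = (b.coord i y) • h := by
        intro i; ext d; simp
      simp only [inv, this, ← smul_tmul, ← sum_tmul]
      congr 1
      exact b.sum_repr y
  have h2 : ∀ w, thetaMap Y D E (inv w) = w := by
    intro w
    ext α
    simp only [inv, map_sum, LinearMap.sum_apply, thetaMap_tmul, LinearMap.comp_apply]
    rw [← map_sum]
    congr 1
    apply b.ext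
    intro j
    simp [Finsupp.single_apply]
  exact ⟨Function.LeftInverse.injective h1, Function.RightInverse.surjective h2⟩

variable [IsNoetherianRing R]

lemma thetaMap_inj [Module.Finite R Y] (hE : Module.Injective R E) :
    Function.Injective (thetaMap (R := R) Y D E) := by
  obtain ⟨F0, _, _, K, _, _, k, g, _, _, _, h⟩ := exists_finite_free_ses (R := R) Y
  obtain ⟨F1, _, _, K1, _, _, k1, g1, _, _, _, h1⟩ := exists_finite_free_ses (R := R) K
  rw [injective_iff_map_eq_zero]
  intro z hz
  obtain ⟨z0, rfl⟩ := LinearMap.rTensor_surjective (D →ₗ[R] E) h.surj z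
  let f : F1 →ₗ[R] F0 := k.comp g1
  have hgf : g.comp f = 0 := by
    ext x; exact h.exact.apply_apply_eq_zero _
  have hex : Function.Exact (LinearMap.lcomp R D g) (LinearMap.lcomp R D f) := by
    intro φ
    constructor
    · intro hφ
      have hk : ∀ x ∈ LinearMap.ker g, φ x = 0 := by
        intro x hx
        obtain ⟨y, rfl⟩ := (h.exact x).1 hx
        obtain ⟨y, rfl⟩ := h1.surj y
        exact LinearMap.congr_fun hφ y
      let e := LinearMap.quotKerEquivOfSurjective g h.surj
      refine ⟨((LinearMap.ker g).liftQ φ hk).comp e.symm.toLinearMap, ?_⟩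
      ext x
      have : e.symm (g x) = Submodule.Quotient.mk x := by
        rw [LinearEquiv.symm_apply_eq]; rfl
      simp only [LinearMap.lcomp_apply, LinearMap.comp_apply, LinearEquiv.coe_coe, this]
      exact Submodule.liftQ_apply _ _ _
    · rintro ⟨ψ, rfl⟩
      ext x
      change ψ ((g.comp f) x) = 0
      rw [hgf]; simp
  obtain ⟨w, hw⟩ := inj_ext_ex hE _ _ hex (thetaMap F0 D E z0) (by
    ext α
    have := LinearMap.congr_fun hz α
    rw [thetaMap_nat] at this
    exact this)
  obtain ⟨z1, rfl⟩ := thetaMap_free.2 w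
  have : z0 = LinearMap.rTensor _ f z1 := by
    apply thetaMap_free.1
    ext α
    rw [thetaMap_nat, ← hw]
    rfl
  rw [this, ← LinearMap.comp_apply, ← LinearMap.rTensor_comp, hgf]; simp

lemma thetaMap_surj [Module.Finite R Y] (hE : Module.Injective R E) :
    Function.Surjective (thetaMap (R := R) Y D E) := by
  obtain ⟨F0, _, _, K, _, _, k, g, _, _, _, h⟩ := exists_finite_free_ses (R := R) Y
  intro w
  have hi : Function.Injective (LinearMap.lcomp R D g) := by
    intro a b hab
    ext x
    obtain ⟨y, rfl⟩ := h.surj x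
    exact LinearMap.congr_fun hab y
  obtain ⟨v, hv⟩ := inj_ext hE _ hi w
  obtain ⟨z, rfl⟩ := thetaMap_free.2 v
  refine ⟨LinearMap.rTensor _ g z, ?_⟩
  ext α
  rw [thetaMap_nat, ← hv]; rfl

lemma kil_hom_aux (hE : Module.Injective R E) (hJ : Module.Injective R J) (s : R) (i : ℕ) :
    ∀ (X : Type u) [AddCommGroup X] [Module R X] [Module.Finite R X],
    Kil s i X D → Kil s i X ((D →ₗ[R] E) →ₗ[R] J) := by
  match i with
  | 0 =>
    intro X _ _ _ h
    rw [kil_zero_iff] at h ⊢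
    intro f
    ext x b
    have : s • (x ⊗ₜ[R] b) = 0 := by
      apply thetaMap_inj hE
      ext α
      have := LinearMap.congr_fun (h α) x
      simp only [LinearMap.smul_apply, LinearMap.zero_apply] at this
      rw [map_smul, LinearMap.smul_apply, thetaMap_tmul, ← map_smul, this]
      simp
    have := congrArg (TensorProduct.lift f) this
    simpa using this
  | 1 =>
    intro X _ _ _ hX
    obtain ⟨F, _, _, K, _, _, f, g, _, _, _, h⟩ := exists_finite_free_ses (R := R) X
    rw [h.kil_one_iff_contra (kil_of_projective _ _)] at hX ⊢
    intro φ
    have hk : ∀ z : K ⊗[R] (D →ₗ[R] E), LinearMap.rTensor _ f z = 0 → s • z = 0 := by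
      intro z hz
      apply thetaMap_inj hE
      ext α
      obtain ⟨β, hβ⟩ := hX α
      rw [map_smul, LinearMap.smul_apply, ← map_smul, ← hβ, ← thetaMap_nat, hz]
      simp
    obtain ⟨ψ, hψ⟩ := inj_ext_ex hJ (LinearMap.ker (LinearMap.rTensor (D →ₗ[R] E) f)).subtype
      (LinearMap.rTensor (D →ₗ[R] E) f) (LinearMap.exact_subtype_ker_map _)
      (s • TensorProduct.lift φ) (by
        ext ⟨z, hz⟩
        change s • TensorProduct.lift φ z = 0
        rw [← map_smul, hk z hz, map_zero])
    refine ⟨TensorProduct.curry ψ, ?_⟩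
    ext a b
    exact LinearMap.congr_fun hψ (a ⊗ₜ b)
  | i+2 =>
    intro X _ _ _ hX
    obtain ⟨F, _, _, K, _, _, f, g, _, _, _, h⟩ := exists_finite_free_ses (R := R) X
    rw [h.contra_shift (kil_of_projective _ _) (kil_of_projective _ _)] at hX ⊢
    exact kil_hom_aux hE hJ s (i+1) K hX

lemma kil_hom (hE : Module.Injective R E) (hJ : Module.Injective R J) {s : R} {i : ℕ}
    {X : Type u} [AddCommGroup X] [Module R X] [Module.Finite R X]
    (h : Kil s i X D) : Kil s i X ((D →ₗ[R] E) →ₗ[R] J) := kil_hom_aux hE hJ s i X h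

lemma kil_hom' (hE : Module.Injective R E) (hJ : Module.Injective R J) {s : R} {i : ℕ}
    {X : Type u} [AddCommGroup X] [Module R X] [Module.Finite R X]
    (h : Kil s i X D) : Kil s i (D →ₗ[R] E) (X →ₗ[R] J) := (kil_balance hJ).1 (kil_hom hE hJ h)

/-- evaluation -/
noncomputable def evMap (D E : Type u) 
    [AddCommGroup D] [Module R D] [AddCommGroup E] [Module R E] :
    D ⊗[R] (D →ₗ[R] E) →ₗ[R] E := TensorProduct.lift (LinearMap.applyₗ)

lemma evMap_bij [Module.Finite R D] (hE : Module.Injective R E)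
    (hD : Function.Bijective (fun r : R => (r • (LinearMap.id : D →ₗ[R] D)))) :
    Function.Bijective (evMap (R := R) D E) := by
  have key : ∀ z, evMap (R := R) D E z = thetaMap D D E z LinearMap.id := by
    intro z
    induction z with
    | zero => simp
    | tmul y h => rfl
    | add a b ha hb => simp [ha, hb]
  constructor
  · rw [injective_iff_map_eq_zero]
    intro z hz
    rw [key] at hz
    apply thetaMap_inj hE
    ext α
    obtain ⟨r, rfl⟩ := hD.2 α
    simp [hz]
  · intro e
    let q : R ≃ₗ[R] (D →ₗ[R] D) := LinearEquiv.ofBijective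
      (LinearMap.toSpanSingleton R _ LinearMap.id) hD
    obtain ⟨z, hz⟩ := thetaMap_surj (D := D) hE ((LinearMap.toSpanSingleton R E e).comp q.symm.toLinearMap)
    refine ⟨z, ?_⟩
    rw [key, hz]
    have : q.symm LinearMap.id = 1 := by
      rw [LinearEquiv.symm_apply_eq]; exact (one_smul R _).symm
    simp [this]

lemma exists_of_hom [Module.Finite R D] (hE : Module.Injective R E)
    (hD : Function.Bijective (fun r : R => (r • (LinearMap.id : D →ₗ[R] D))))
    (φ : (D →ₗ[R] E) →ₗ[R] (D →ₗ[R] J)) : ∃ ψ : E →ₗ[R] J, ∀ h, φ h = ψ.comp h := by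
  let q := LinearEquiv.ofBijective _ (evMap_bij (E := E) hE hD)
  refine ⟨(TensorProduct.lift φ.flip).comp q.symm.toLinearMap, ?_⟩
  intro h
  ext d
  have : q.symm (h d) = d ⊗ₜ h := by
    rw [LinearEquiv.symm_apply_eq]; rfl
  simp [this]

end PartD


section PartE
variable {R : Type u} [CommRing R]

lemma nakayama_prime {M : Type u} [AddCommGroup M] [Module R M] [Module.Finite R M]
    (p : Ideal R) [hp : p.IsPrime] (s x : R) (hs : s ∉ p) (hx : x ∈ p)
    (h : ∀ m : M, ∃ m' : M, s • m = x • m') : ∃ t ∉ p, ∀ m : M, t • m = 0 := by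
  obtain ⟨q, hq, -, hc, h0⟩ :=
    LinearMap.exists_monic_and_natDegree_eq_and_coeff_mem_pow_and_aeval_eq_zero R
      (algebraMap R (Module.End R M) s) p (by
        rintro _ ⟨m, rfl⟩
        obtain ⟨m', hm'⟩ := h m
        rw [Module.algebraMap_end_apply, hm']
        exact Submodule.smul_mem_smul hx trivial)
  refine ⟨q.eval s, ?_, ?_⟩
  · intro hmem
    rw [Polynomial.eval_eq_sum_range, Finset.sum_range_succ, hq.coeff_natDegree, one_mul] at hmem
    have h1 : ∑ k ∈ Finset.range q.natDegree, q.coeff k * s ^ k ∈ p := by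
      apply Ideal.sum_mem
      intro k hk
      apply Ideal.mul_mem_right
      exact Ideal.pow_le_self (by have := Finset.mem_range.1 hk; omega) (hc k)
    exact hs (hp.mem_of_pow_mem _ ((Submodule.add_mem_iff_right p h1).1 hmem))
  · intro m
    rw [Polynomial.aeval_algebraMap_apply] at h0
    have := LinearMap.congr_fun h0 m
    rwa [Module.algebraMap_end_apply, Polynomial.coe_aeval_eq_eval] at this

variable (D : Type u) [AddCommGroup D] [Module R D]

/-- local vanishing of `Ext^i(X,D)` at `p`. -/
def VV (p : Ideal R) (i : ℕ) (X : Type u) [AddCommGroup X] [Module R X] : Prop :=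
  ∃ s ∉ p, Kil s i X D

variable {D} {A B C X Y : Type u} [AddCommGroup A] [Module R A] [AddCommGroup B] [Module R B]
  [AddCommGroup C] [Module R C] [AddCommGroup X] [Module R X] [AddCommGroup Y] [Module R Y]
  {p : Ideal R} {i : ℕ}

lemma VV.congr (h : VV D p i X) (e : X ≃ₗ[R] Y) : VV D p i Y := by
  obtain ⟨s, hs, h⟩ := h
  exact ⟨s, hs, h.congr_left e⟩

lemma VV.of_smul {s : R} (hs : s ∉ p) (h : ∀ x : X, s • x = 0) : VV D p i X :=
  ⟨s, hs, kil_of_smul_left h i⟩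

lemma VV.of_one [hp : p.IsPrime] (h : Kil (1:R) i X D) : VV D p i X :=
  ⟨1, fun h1 => hp.ne_top ((Ideal.eq_top_iff_one p).2 h1), h⟩

lemma prime_mul [hp : p.IsPrime] {s t : R} (hs : s ∉ p) (ht : t ∉ p) : s * t ∉ p := by
  intro h
  rcases hp.mem_or_mem h with h | h
  · exact hs h
  · exact ht h

lemma SES.VV_mid [p.IsPrime] {f : A →ₗ[R] B} {g : B →ₗ[R] C} (h : SES f g)
    (h1 : VV D p i A) (h2 : VV D p i C) : VV D p i B := by
  obtain ⟨s, hs, h1⟩ := h1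
  obtain ⟨t, ht, h2⟩ := h2
  exact ⟨_, prime_mul ht hs, h.contra_mid h1 h2⟩

lemma SES.VV_left [p.IsPrime] {f : A →ₗ[R] B} {g : B →ₗ[R] C} (h : SES f g)
    (h1 : VV D p i B) (h2 : VV D p (i+1) C) : VV D p i A := by
  obtain ⟨s, hs, h1⟩ := h1
  obtain ⟨t, ht, h2⟩ := h2
  exact ⟨_, prime_mul hs ht, h.contra_left h1 h2⟩

lemma SES.VV_right [p.IsPrime] {f : A →ₗ[R] B} {g : B →ₗ[R] C} (h : SES f g)
    (h1 : VV D p i A) (h2 : VV D p (i+1) B) : VV D p (i+1) C := by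
  obtain ⟨s, hs, h1⟩ := h1
  obtain ⟨t, ht, h2⟩ := h2
  exact ⟨_, prime_mul hs ht, h.contra_right h1 h2⟩

lemma VV_quot_of_not_le {q : Ideal R} (h : ¬ q ≤ p) : VV D p i (R ⧸ q) := by
  obtain ⟨s, hs, hsp⟩ := Set.not_subset.1 h
  refine VV.of_smul hsp ?_
  intro x
  obtain ⟨r, rfl⟩ := Ideal.Quotient.mk_surjective x
  have : s • Ideal.Quotient.mk q r = Ideal.Quotient.mk q (s * r) := rfl
  rw [this, Ideal.Quotient.eq_zero_iff_mem]
  exact Ideal.mul_mem_right _ _ hs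

variable [IsNoetherianRing R]

lemma VV_of_primes [p.IsPrime] [hX : Module.Finite R X]
    (h : ∀ q : Ideal R, q.IsPrime → Module.annihilator R X ≤ q → VV D p i (R ⧸ q)) :
    VV D p i X := by
  revert h
  refine IsNoetherianRing.induction_on_isQuotientEquivQuotientPrime R hX
    (motive := fun N _ _ _ =>
      (∀ q : Ideal R, q.IsPrime → Module.annihilator R N ≤ q → VV D p i (R ⧸ q)) → VV D p i N)
    ?_ ?_ ?_
  · intro N _ _ _ _ _
    exact VV.of_one (kil_of_smul_left (fun x => Subsingleton.elim _ _) _)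
  · intro N _ _ _ q e h
    refine VV.congr (h q.1 q.2 ?_) e.symm
    rw [e.annihilator_eq, Ideal.annihilator_quotient]
  · intro N1 _ _ _ N2 _ _ _ N3 _ _ _ f g hf hg hfg h1 h3 h
    have hs : SES f g := ⟨hf, hfg, hg⟩
    refine hs.VV_mid (h1 fun q hq hle => h q hq (le_trans ?_ hle))
      (h3 fun q hq hle => h q hq (le_trans ?_ hle))
    · exact LinearMap.annihilator_le_of_injective f hf
    · exact LinearMap.annihilator_le_of_surjective g hg

/-- multiplication SES. -/
lemma ses_smul (x : R) (hx : ∀ a : A, x • a = 0 → a = 0) :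
    SES (x • (LinearMap.id : A →ₗ[R] A)) (LinearMap.range (x • (LinearMap.id : A →ₗ[R] A))).mkQ :=
  ses_coker _ ((injective_iff_map_eq_zero _).2 hx)

open Abelian in
lemma VV_nakayama [p.IsPrime] [Module.Finite R A] [Module.Finite R D] (x : R) (hxp : x ∈ p)
    {g : A →ₗ[R] C} (h : SES (x • (LinearMap.id : A →ₗ[R] A)) g) (hC : VV D p (i+1) C) :
    VV D p i A := by
  obtain ⟨s, hs, hC⟩ := hC
  have : Module.Finite R (ModuleCat.of R A) := ‹Module.Finite R A›
  have : Module.Finite R (ModuleCat.of R D) := ‹Module.Finite R D›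
  obtain ⟨t, ht, hh⟩ := nakayama_prime (M := Ext (ModuleCat.of R A) (ModuleCat.of R D) i)
    p s x hs hxp (by
      intro e
      obtain ⟨y, hy⟩ := Ext.contravariant_sequence_exact₁ h.se _ (s • e) (add_comm 1 i) (by
        rw [Ext.comp_smul]; exact hC _)
      refine ⟨y, ?_⟩
      rw [← hy]
      change (Ext.mk₀ (x • 𝟙 (ModuleCat.of R A))).comp y _ = _
      simp [Ext.mk₀_smul])
  exact ⟨t, ht, hh⟩

open Abelian in
lemma kil_cov_smul {x s : R} {g : A →ₗ[R] C} (h : SES (x • (LinearMap.id : A →ₗ[R] A)) g)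
    (hx : ∀ y : X, x • y = 0) (hC : Kil s i X C) : Kil s (i+1) X A := by
  intro e
  obtain ⟨y, hy⟩ := Ext.covariant_sequence_exact₁ _ h.se e (by
    have := kil_of_smul_left hx (i+1) e
    rw [Ext.smul_eq_comp_mk₀] at this
    exact this) rfl
  rw [← hy, ← Ext.smul_comp, show s • y = 0 from hC y, Ext.zero_comp]

/-- quotient by x: V from bigger primes -/
lemma VV_step [p.IsPrime] [Module.Finite R D] (q : Ideal R) [hq : q.IsPrime] (x : R) (hxp : x ∈ p)
    (hxq : x ∉ q)
    (h : ∀ q' : Ideal R, q'.IsPrime → q < q' → VV D p (i+1) (R ⧸ q')) : VV D p i (R ⧸ q) := by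
  have hs := ses_smul (A := R ⧸ q) x (by
    intro a ha
    obtain ⟨r, rfl⟩ := Ideal.Quotient.mk_surjective a
    have h1 : Ideal.Quotient.mk q (x * r) = 0 := ha
    rw [Ideal.Quotient.eq_zero_iff_mem] at h1 ⊢
    exact (hq.mem_or_mem h1).resolve_left hxq)
  refine VV_nakayama x hxp hs (VV_of_primes ?_)
  intro q' hq' hle
  refine h q' hq' (lt_of_le_of_ne ?_ ?_)
  · refine le_trans ?_ hle
    refine le_trans ?_ (LinearMap.annihilator_le_of_surjective _ hs.surj)
    rw [Ideal.annihilator_quotient]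
  · rintro rfl
    apply hxq
    apply hle
    rw [Module.mem_annihilator]
    intro c
    obtain ⟨c, rfl⟩ := hs.surj c
    rw [← map_smul]
    exact hs.exact.apply_apply_eq_zero c

lemma VV_all [hp : p.IsPrime] [Module.Finite R D] {r : ℕ} (hr : ∀ i, r < i → VV D p i (R ⧸ p)) :
    ∀ (X : Type u) [AddCommGroup X] [Module R X] [Module.Finite R X] (i : ℕ), r < i → VV D p i X := by
  have key : ∀ q : Ideal R, q.IsPrime → ∀ i, r < i → VV D p i (R ⧸ q) := by
    intro q
    induction q using WellFoundedGT.induction with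
    | ind q ih =>
      intro hq i hi
      by_cases hqp : q ≤ p
      · rcases eq_or_lt_of_le hqp with rfl | hlt
        · exact hr i hi
        · obtain ⟨x, hxp, hxq⟩ := SetLike.exists_of_lt hlt
          exact VV_step q x hxp hxq fun q' hq' hlt' => ih q' hlt' hq' (i+1) (by omega)
      · exact VV_quot_of_not_le hqp
  intro X _ _ _ i hi
  exact VV_of_primes fun q hq _ => key q hq i hi

lemma VV_mono {q : Ideal R} (h : q ≤ p) (hV : VV D p i X) : VV D q i X := by
  obtain ⟨s, hs, hV⟩ := hV
  exact ⟨s, fun h1 => hs (h h1), hV⟩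

/-- Bass -/
lemma not_VV_height [Module.Finite R D]
    (hD : Function.Injective (fun r : R => (r • (LinearMap.id : D →ₗ[R] D)))) (h : ℕ) :
    ∀ p : PrimeSpectrum R, Order.height p = (h : ℕ∞) → ¬ VV D p.1 h (R ⧸ p.1) := by
  induction h with
  | zero =>
    intro p hp
    have hann : Module.annihilator R D = ⊥ := by
      rw [eq_bot_iff]
      intro x hx
      apply hD
      ext d
      simpa using Module.mem_annihilator.1 hx d
    have hmin : IsMin p := by
      rw [← Order.height_eq_zero]; simpa using hp
    have hmem : p.1 ∈ (Module.annihilator R D).minimalPrimes := by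
      refine ⟨⟨p.2, by rw [hann]; exact bot_le⟩, ?_⟩
      intro q hq hle
      exact hmin (b := ⟨q, hq.1⟩) hle
    have h2 := Module.associatedPrimes.minimalPrimes_annihilator_subset_associatedPrimes R D hmem
    rw [AssociatedPrimes.mem_iff, isAssociatedPrime_iff] at h2
    obtain ⟨-, m, hm⟩ := h2
    rintro ⟨s, hs, hk⟩
    rw [kil_zero_iff] at hk
    have hle : p.1 ≤ LinearMap.ker (LinearMap.toSpanSingleton R D m) := by
      intro x hx
      rw [hm, Submodule.mem_colon_singleton] at hx
      simpa using hx
    have := LinearMap.congr_fun (hk (Submodule.liftQ p.1 (LinearMap.toSpanSingleton R D m) hle))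
      (Submodule.Quotient.mk 1)
    apply hs
    rw [hm, Submodule.mem_colon_singleton]
    rw [LinearMap.smul_apply, Submodule.liftQ_apply] at this
    simpa using this
  | succ h ih =>
    intro p hp hV
    push_cast at hp
    rw [Order.height_eq_coe_add_one_iff] at hp
    obtain ⟨hlt, ⟨q, hqp, hq⟩, hall⟩ := hp
    have := p.2
    have := q.2
    apply ih q hq
    obtain ⟨x, hxp, hxq⟩ := SetLike.exists_of_lt (show q.1 < p.1 from hqp)
    refine VV_mono (p := p.1) (show q.1 ≤ p.1 from hqp.le) (VV_step q.1 x hxp hxq ?_)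
    intro q' hq' hlt'
    by_cases hle : q' ≤ p.1
    · rcases eq_or_lt_of_le hle with rfl | hlt2
      · exact hV
      · exfalso
        have h1 := hall ⟨q', hq'⟩ hlt2
        have h2 : Order.height q + 1 ≤ Order.height (⟨q', hq'⟩ : PrimeSpectrum R) :=
          Order.height_add_one_le (show q < ⟨q', hq'⟩ from hlt')
        rw [hq] at h2
        have h3 := h2.trans h1
        exact absurd h3 (by exact_mod_cast (by omega : ¬ (h + 1 ≤ h)))
    · exact VV_quot_of_not_le hle

end PartE


section PartE2
variable {R : Type u} [CommRing R] {D : Type u} [AddCommGroup D] [Module R D]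

/-- elements killed by something outside `p`. -/
def outTors (p : Ideal R) [hp : p.IsPrime] (N : Type u) [AddCommGroup N] [Module R N] :
    Submodule R N where
  carrier := {n | ∃ t ∉ p, t • n = 0}
  zero_mem' := ⟨1, fun h1 => hp.ne_top ((Ideal.eq_top_iff_one p).2 h1), smul_zero _⟩
  add_mem' := by
    rintro a b ⟨s, hs, ha⟩ ⟨t, ht, hb⟩
    refine ⟨s * t, prime_mul hs ht, ?_⟩
    rw [smul_add, mul_comm, mul_smul, ha, mul_comm, mul_smul, hb]; simp
  smul_mem' := by
    rintro c a ⟨s, hs, ha⟩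
    exact ⟨s, hs, by rw [smul_comm, ha, smul_zero]⟩

lemma outTors_fg (p : Ideal R) [hp : p.IsPrime] (N : Type u) [AddCommGroup N] [Module R N]
    (M : Submodule R N) (hM : M.FG) (hle : M ≤ outTors p N) : ∃ t ∉ p, ∀ n ∈ M, t • n = 0 := by
  induction M, hM using Submodule.fg_induction with
  | singleton x =>
    obtain ⟨t, ht, h⟩ := hle (Submodule.mem_span_singleton_self x)
    refine ⟨t, ht, ?_⟩
    intro n hn
    obtain ⟨c, rfl⟩ := Submodule.mem_span_singleton.1 hn
    rw [smul_comm, h, smul_zero]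
  | sup M1 M2 h1 h2 ih1 ih2 =>
    obtain ⟨s, hs, hs1⟩ := ih1 (le_sup_left.trans hle)
    obtain ⟨t, ht, ht1⟩ := ih2 (le_sup_right.trans hle)
    refine ⟨s * t, prime_mul hs ht, ?_⟩
    intro n hn
    obtain ⟨a, ha, b, hb, rfl⟩ := Submodule.mem_sup.1 hn
    rw [smul_add, mul_comm, mul_smul, hs1 a ha, mul_comm, mul_smul, ht1 b hb]; simp

variable [IsNoetherianRing R]

lemma lemL (p : Ideal R) [hp : p.IsPrime] [Module.Finite R D] {r : ℕ}
    (hr : ∀ i, r < i → VV D p i (R ⧸ p)) (hr0 : ¬ VV D p r (R ⧸ p)) (a : ℕ) :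
    ∀ (N : Type u) [AddCommGroup N] [Module R N] [Module.Finite R N] (s : ℕ),
      (∀ i, s < i → VV D p i N) → a + s < r → ∃ t ∉ p, Kil t a (R ⧸ p) N := by
  have step : ∀ (N : Type u) [AddCommGroup N] [Module R N] [Module.Finite R N] (s : ℕ),
      (∀ i, s < i → VV D p i N) → s < r →
      (∀ i, s < i → VV D p i (N ⧸ outTors p N)) ∧ Subsingleton ((R ⧸ p) →ₗ[R] (N ⧸ outTors p N)) ∧
      ∃ t ∉ p, ∀ n : outTors p N, t • n = 0 := by
    intro N _ _ _ s hN hsr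
    obtain ⟨t, ht, htN⟩ := outTors_fg p N (outTors p N) (IsNoetherian.noetherian _) le_rfl
    have htN' : ∀ n : outTors p N, t • n = 0 := fun n => Subtype.ext (htN n n.2)
    refine ⟨?_, ?_, t, ht, htN'⟩
    · intro i hi
      obtain ⟨j, rfl⟩ : ∃ j, i = j + 1 := ⟨i - 1, by omega⟩
      exact (ses_mkQ (outTors p N)).VV_right (VV.of_smul ht htN') (hN _ hi)
    · refine ⟨fun f g => ?_⟩
      suffices H : ∀ f : (R ⧸ p) →ₗ[R] (N ⧸ outTors p N), f = 0 by rw [H f, H g]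
      intro f
      obtain ⟨n, hn⟩ := Submodule.mkQ_surjective _ (f 1)
      have hmem : n ∈ outTors p N := by
        by_contra hcon
        have hpn : ∀ x ∈ p, x • (t • n) = 0 := by
          intro x hx
          rw [smul_comm]
          apply htN
          rw [← Submodule.Quotient.mk_eq_zero, ← Submodule.mkQ_apply, map_smul, hn, ← map_smul]
          have : x • (1 : R ⧸ p) = 0 := by
            have h1 : x • (1 : R ⧸ p) = Ideal.Quotient.mk p (x * 1) := rfl
            rw [h1, Ideal.Quotient.eq_zero_iff_mem]; exact Ideal.mul_mem_right _ _ hx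
          rw [this, map_zero]
        let φ : (R ⧸ p) →ₗ[R] N := Submodule.liftQ p (LinearMap.toSpanSingleton R N (t • n)) (by
          intro x hx; exact hpn x hx)
        have hφ : Function.Injective φ := by
          rw [injective_iff_map_eq_zero]
          intro y hy
          obtain ⟨x, rfl⟩ := Ideal.Quotient.mk_surjective y
          rw [Ideal.Quotient.eq_zero_iff_mem]
          by_contra hx
          apply hcon
          refine ⟨x * t, prime_mul hx ht, ?_⟩
          rw [mul_smul]; exact hy
        exact hr0 ((ses_coker φ hφ).VV_left (hN r hsr) (VV_all hr _ (r+1) (by omega)))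
      have h1 : f 1 = 0 := by
        rw [← hn]; exact (Submodule.Quotient.mk_eq_zero _).2 hmem
      ext
      simpa using h1
  induction a with
  | zero =>
    intro N _ _ _ s hN hs
    obtain ⟨h1, h2, t, ht, h3⟩ := step N s hN (by omega)
    refine ⟨t * 1, by simpa using ht, (ses_mkQ (outTors p N)).cov_mid (kil_of_smul_right h3 _) ?_⟩
    rw [kil_zero_iff]
    intro f; exact Subsingleton.elim _ _
  | succ a ih =>
    intro N _ _ _ s hN hs
    obtain ⟨h1, h2, t, ht, h3⟩ := step N s hN (by omega)
    obtain ⟨x, hx, hreg⟩ := IsSMulRegular.subsingleton_linearMap_iff.1 h2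
    rw [Ideal.annihilator_quotient] at hx
    have hse := ses_smul (A := N ⧸ outTors p N) x (fun a ha => hreg (by simpa using ha))
    obtain ⟨t', ht', h4⟩ := ih _ (s+1) (fun i hi => by
      obtain ⟨j, rfl⟩ : ∃ j, i = j + 1 := ⟨i - 1, by omega⟩
      exact hse.VV_right (h1 j (by omega)) (h1 _ (by omega))) (by omega)
    refine ⟨t * t', prime_mul ht ht', (ses_mkQ (outTors p N)).cov_mid (kil_of_smul_right h3 _)
      (kil_cov_smul hse ?_ h4)⟩
    intro y
    exact Module.mem_annihilator.1 (by rw [Ideal.annihilator_quotient]; exact hx) y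

lemma VV_ne (p : Ideal R) [hp : p.IsPrime] [Module.Finite R D]
    (hD : Function.Injective (fun r : R => (r • (LinearMap.id : D →ₗ[R] D))))
    (h : ℕ) (hh : Order.height (⟨p, hp⟩ : PrimeSpectrum R) = (h : ℕ∞)) (n : ℕ)
    (hn : ∀ i, n < i → Kil (1:R) i (R ⧸ p) D) (hDD : ∀ i, 0 < i → Kil (1:R) i D D) (i : ℕ)
    (hi : i ≠ h) : VV D p i (R ⧸ p) := by
  classical
  have h1 : ¬ VV D p h (R ⧸ p) := not_VV_height hD h ⟨p, hp⟩ hh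
  have hhn : h ≤ n := by
    by_contra hlt
    exact h1 (VV.of_one (hn h (by omega)))
  obtain ⟨r, hr0, hr⟩ : ∃ r, ¬ VV D p r (R ⧸ p) ∧ ∀ i, r < i → VV D p i (R ⧸ p) := by
    refine ⟨Nat.findGreatest (fun i => ¬ VV D p i (R ⧸ p)) n,
      Nat.findGreatest_spec (P := fun i => ¬ VV D p i (R ⧸ p)) hhn h1, ?_⟩
    intro i hi
    by_cases hin : i ≤ n
    · exact not_not.1 (Nat.findGreatest_is_greatest hi hin)
    · exact VV.of_one (hn i (by omega))
  have hl : ∀ a, a < r → VV D p a (R ⧸ p) := fun a ha =>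
    lemL p hr hr0 a D 0 (fun i hi => VV.of_one (hDD i hi)) (by omega)
  have : r = h := by
    rcases lt_trichotomy r h with hlt | heq | hgt
    · exact absurd (hr h hlt) h1
    · exact heq
    · exact absurd (hl h hgt) h1
  subst this
  rcases lt_or_gt_of_ne hi with hlt | hgt
  · exact hl i hlt
  · exact hr i hgt

variable {Ep : Type u} [AddCommGroup Ep] [Module R Ep]

lemma hull_facts (p : Ideal R) [hp : p.IsPrime] (hinj : Module.Injective R Ep)
    (f : (R ⧸ p) →ₗ[R] Ep) (hf : Function.Injective f)
    (hess : ∀ N : Submodule R Ep, N ≠ ⊥ → N ⊓ LinearMap.range f ≠ ⊥) :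
    (∀ m : Ep, ∀ q : Ideal R, q.IsPrime → (∀ x, x ∈ q ↔ x • m = 0) → q = p) ∧
    (∀ s ∉ p, ∀ m : Ep, s • m = 0 → m = 0) ∧
    (∀ s ∉ p, ∀ m : Ep, ∃ m', s • m' = m) := by
  have hann : ∀ y : R ⧸ p, y ≠ 0 → ∀ x : R, x • f y = 0 ↔ x ∈ p := by
    intro y hy x
    rw [← map_smul, map_eq_zero_iff f hf]
    obtain ⟨r, rfl⟩ := Ideal.Quotient.mk_surjective y
    have h1 : x • Ideal.Quotient.mk p r = Ideal.Quotient.mk p (x * r) := rfl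
    rw [h1, Ideal.Quotient.eq_zero_iff_mem]
    rw [Ne, Ideal.Quotient.eq_zero_iff_mem] at hy
    exact ⟨fun h => (hp.mem_or_mem h).resolve_right hy, fun h => Ideal.mul_mem_right _ _ h⟩
  have hpick : ∀ N : Submodule R Ep, N ≠ ⊥ → ∃ y : R ⧸ p, y ≠ 0 ∧ f y ∈ N := by
    intro N hN
    obtain ⟨z, hz, hz0⟩ := Submodule.exists_mem_ne_zero_of_ne_bot (hess N hN)
    obtain ⟨hzN, y, rfl⟩ := Submodule.mem_inf.1 hz
    exact ⟨y, fun h => hz0 (by rw [h, map_zero]), hzN⟩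
  have hreg : ∀ s ∉ p, ∀ m : Ep, s • m = 0 → m = 0 := by
    intro s hs m hm
    by_contra hm0
    obtain ⟨y, hy, hyN⟩ := hpick (R ∙ m) (by simpa using hm0)
    obtain ⟨c, hc⟩ := Submodule.mem_span_singleton.1 hyN
    exact hs ((hann y hy s).1 (by rw [← hc, smul_comm, hm, smul_zero]))
  refine ⟨?_, hreg, ?_⟩
  · intro m q hq hqm
    have hm0 : m ≠ 0 := by
      rintro rfl
      exact hq.ne_top ((Ideal.eq_top_iff_one q).2 ((hqm 1).2 (by simp)))
    obtain ⟨y, hy, hyN⟩ := hpick (R ∙ m) (by simpa using hm0)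
    obtain ⟨c, hc⟩ := Submodule.mem_span_singleton.1 hyN
    have hcq : c ∉ q := by
      intro h
      rw [(hqm c).1 h] at hc
      exact hy ((map_eq_zero_iff f hf).1 hc.symm)
    ext x
    rw [← hann y hy x, ← hc, ← mul_smul, ← hqm]
    exact ⟨fun h => Ideal.mul_mem_right _ _ h, fun h => (hq.mem_or_mem h).resolve_right hcq⟩
  · intro s hs m
    obtain ⟨g, hg⟩ := inj_ext hinj (s • (LinearMap.id : Ep →ₗ[R] Ep))
      ((injective_iff_map_eq_zero _).2 (hreg s hs)) LinearMap.id
    refine ⟨g m, ?_⟩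
    rw [← map_smul]
    exact LinearMap.congr_fun hg m

lemma VV_sub_hull (p : Ideal R) [hp : p.IsPrime]
    (hass : ∀ m : Ep, ∀ q : Ideal R, q.IsPrime → (∀ x, x ∈ q ↔ x • m = 0) → q = p) (i : ℕ)
    (hV : VV D p i (R ⧸ p)) (X : Submodule R Ep) (hX : X.FG) : VV D p i X := by
  have : Module.Finite R X := Module.Finite.iff_fg.2 hX
  refine VV_of_primes ?_
  intro q hq hle
  obtain ⟨q', hq', hle'⟩ := Ideal.exists_minimalPrimes_le hle
  have h2 := Module.associatedPrimes.minimalPrimes_annihilator_subset_associatedPrimes R X hq'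
  rw [AssociatedPrimes.mem_iff, isAssociatedPrime_iff] at h2
  obtain ⟨hpr, m, hm⟩ := h2
  have : q' = p := hass m q' hpr (by
    intro x
    rw [hm, Submodule.mem_colon_singleton, Submodule.mem_bot, ← Submodule.coe_smul,
      Submodule.coe_eq_zero])
  subst this
  by_cases hqp : q ≤ q'
  · rw [le_antisymm hqp hle']; exact hV
  · exact VV_quot_of_not_le hqp

end PartE2


section PartF
variable {R : Type u} [CommRing R] {J Ep : Type u} [AddCommGroup J] [Module R J]
  [AddCommGroup Ep] [Module R Ep]

open TensorProduct

lemma kil_colim (hJ : Module.Injective R J) (hJc : Cogen R J) (p : Ideal R)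
    (hreg : ∀ s ∉ p, ∀ m : Ep, s • m = 0 → m = 0)
    (hdiv : ∀ s ∉ p, ∀ m : Ep, ∃ m', s • m' = m) (i : ℕ) :
    ∀ (M : Type u) [AddCommGroup M] [Module R M],
    (∀ X : Submodule R Ep, X.FG → ∃ s ∉ p, Kil s i M (X →ₗ[R] J)) →
    Kil (1:R) i M (Ep →ₗ[R] J) := by
  have hinv : ∀ s ∉ p, ∃ g : Ep →ₗ[R] Ep, ∀ e, g (s • e) = e := by
    intro s hs
    let q : Ep ≃ₗ[R] Ep := LinearEquiv.ofBijective (s • (LinearMap.id : Ep →ₗ[R] Ep))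
      ⟨(injective_iff_map_eq_zero _).2 (hreg s hs), hdiv s hs⟩
    exact ⟨q.symm.toLinearMap, fun e => q.symm_apply_apply e⟩
  match i with
  | 0 =>
    intro M _ _ h
    rw [kil_zero_iff]
    intro φ
    ext m e
    obtain ⟨s, hs, hk⟩ := h (R ∙ e) (Submodule.fg_span_singleton e)
    rw [kil_zero_iff] at hk
    obtain ⟨g, hg⟩ := hinv s hs
    have h1 := LinearMap.congr_fun (LinearMap.congr_fun
      (hk ((LinearMap.lcomp R J (g.comp (R ∙ e).subtype)).comp φ)) m)
      ⟨e, Submodule.mem_span_singleton_self e⟩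
    change s • φ m (g e) = 0 at h1
    rw [← map_smul, ← map_smul, hg] at h1
    simpa using h1
  | 1 =>
    intro M _ _ hM
    obtain ⟨F, _, _, K, _, _, f, g, hF, h⟩ := exists_free_ses (R := R) M
    rw [h.kil_one_iff_contra (kil_of_projective _ _)]
    intro φ
    have hk : ∀ z : K ⊗[R] Ep, LinearMap.rTensor _ f z = 0 → z = 0 := by
      intro z hz
      obtain ⟨X, hX, hzX⟩ := TensorProduct.exists_finite_submodule_right_of_setFinite {z}
        (Set.finite_singleton z)
      obtain ⟨z0, rfl⟩ := hzX (Set.mem_singleton z)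
      obtain ⟨s, hs, hk⟩ := hM X (Module.Finite.iff_fg.1 hX)
      rw [h.kil_one_iff_contra (kil_of_projective _ _)] at hk
      have hz1 : LinearMap.rTensor X f z0 = 0 := by
        apply Module.Flat.lTensor_preserves_injective_linearMap (M := F) X.subtype
          Subtype.val_injective
        rw [map_zero, ← hz, ← LinearMap.comp_apply, ← LinearMap.comp_apply,
          LinearMap.lTensor_comp_rTensor, LinearMap.rTensor_comp_lTensor]
      have hz2 : s • z0 = 0 := by
        apply hJc
        intro α
        obtain ⟨ψ, hψ⟩ := hk (TensorProduct.curry α)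
        have : (TensorProduct.lift ψ).comp (LinearMap.rTensor X f) = s • α := by
          apply TensorProduct.ext
          exact hψ
        have h3 := LinearMap.congr_fun this z0
        rw [LinearMap.comp_apply, hz1, map_zero] at h3
        rw [map_smul]; exact h3.symm
      obtain ⟨g, hg⟩ := hinv s hs
      have h4 : (LinearMap.lTensor K g) (s • LinearMap.lTensor K X.subtype z0) =
          LinearMap.lTensor K X.subtype z0 := by
        rw [map_smul]
        have : s • LinearMap.lTensor K g = LinearMap.id := by
          apply TensorProduct.ext'
          intro a b
          simp only [LinearMap.smul_apply, LinearMap.lTensor_tmul, LinearMap.id_apply]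
          rw [← tmul_smul, ← map_smul, hg]
        exact LinearMap.congr_fun this _
      rw [← h4, ← map_smul, hz2]; simp
    obtain ⟨ψ, hψ⟩ := inj_ext hJ (LinearMap.rTensor Ep f) ((injective_iff_map_eq_zero _).2 hk)
      (TensorProduct.lift φ)
    refine ⟨TensorProduct.curry ψ, ?_⟩
    ext a b
    rw [one_smul]
    exact LinearMap.congr_fun hψ (a ⊗ₜ b)
  | i+2 =>
    intro M _ _ hM
    obtain ⟨F, _, _, K, _, _, f, g, hF, h⟩ := exists_free_ses (R := R) M
    rw [h.contra_shift (kil_of_projective _ _) (kil_of_projective _ _)]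
    refine kil_colim hJ hJc p hreg hdiv (i+1) K ?_
    intro X hX
    obtain ⟨s, hs, hk⟩ := hM X hX
    rw [h.contra_shift (kil_of_projective _ _) (kil_of_projective _ _)] at hk
    exact ⟨s, hs, hk⟩

end PartF


section PartG
variable {R : Type u} [CommRing R]
variable {A B C D X Y J : Type u} [AddCommGroup A] [Module R A] [AddCommGroup B] [Module R B]
  [AddCommGroup C] [Module R C] [AddCommGroup X] [Module R X] [AddCommGroup Y] [Module R Y]
  [AddCommGroup D] [Module R D] [AddCommGroup J] [Module R J]

open TensorProduct

lemma SES.homD {f : A →ₗ[R] B} {g : B →ₗ[R] C} (h : SES f g) (hB : Module.Injective R B)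
    (hA : Kil (1:R) 1 D A) :
    SES (f.compRight R (M := D)) (g.compRight R (M := D)) where
  inj := by
    intro a b hab
    ext x
    exact h.inj (LinearMap.congr_fun hab x)
  exact := by
    intro φ
    constructor
    · intro hφ
      have h1 : ∀ x, ∃ a, f a = φ x := fun x => (h.exact (φ x)).1 (LinearMap.congr_fun hφ x)
      choose a ha using h1
      refine ⟨{ toFun := a, map_add' := ?_, map_smul' := ?_ }, ?_⟩
      · intro x y; apply h.inj; rw [map_add, ha, ha, ha, map_add]
      · intro c x; apply h.inj; rw [map_smul, ha, ha, map_smul]; rfl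
      · ext x; exact ha x
    · rintro ⟨ψ, rfl⟩
      ext x
      exact h.exact.apply_apply_eq_zero _
  surj := by
    intro φ
    obtain ⟨ψ, hψ⟩ := (h.kil_one_iff_cov (kil_of_injective hB 0 1)).1 hA φ
    exact ⟨ψ, by rw [one_smul] at hψ; exact hψ⟩

lemma injective_of_kil (h : ∀ (M : Type u) [AddCommGroup M] [Module R M], Kil (1:R) 1 M Y) :
    Module.Injective R Y := by
  refine ⟨fun X Z _ _ _ _ f hf g => ?_⟩
  obtain ⟨ψ, hψ⟩ := ((ses_coker f hf).kil_one_iff_contra (h Z)).1 (h _) g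
  exact ⟨ψ, fun x => by simpa using LinearMap.congr_fun hψ x⟩

lemma injective_of_kil_fg (h : ∀ (M : Type u) [AddCommGroup M] [Module R M] [Module.Finite R M],
    Kil (1:R) 1 M Y) : Module.Injective R Y := by
  apply Module.Baer.injective
  intro I g
  obtain ⟨ψ, hψ⟩ := ((ses_mkQ I).kil_one_iff_contra (h R)).1 (h _) g
  exact ⟨ψ, fun x hx => by simpa using LinearMap.congr_fun hψ ⟨x, hx⟩⟩

/-- injective dimension at most n -/
def IdLe (R : Type u) [CommRing R] (n : ℕ) (Y : Type u) [AddCommGroup Y] [Module R Y] : Prop :=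
  ∀ (M : Type u) [AddCommGroup M] [Module R M] (i : ℕ), n < i → Kil (1:R) i M Y

lemma SES.idLe {f : A →ₗ[R] B} {g : B →ₗ[R] C} (h : SES f g) (hB : Module.Injective R B) {n : ℕ}
    (hA : IdLe R (n+1) A) : IdLe R n C := by
  intro M _ _ i hi
  obtain ⟨j, rfl⟩ : ∃ j, i = j + 1 := ⟨i - 1, by omega⟩
  simpa using h.cov_right (kil_of_injective hB j 1) (hA M (j+1+1) (by omega))

lemma idLe_of_fg (n : ℕ) : ∀ (B : Type u) [AddCommGroup B] [Module R B],
    (∀ (M : Type u) [AddCommGroup M] [Module R M] [Module.Finite R M] (i : ℕ), n < i →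
      Kil (1:R) i M B) → IdLe R n B := by
  induction n with
  | zero =>
    intro B _ _ h M _ _ i hi
    obtain ⟨j, rfl⟩ : ∃ j, i = j + 1 := ⟨i - 1, by omega⟩
    exact kil_of_injective (injective_of_kil_fg (fun M _ _ _ => h M 1 (by omega))) _ _
  | succ n ih =>
    intro B _ _ h M _ _ i hi
    obtain ⟨I, _, _, B', _, _, f, g, hI, hs⟩ := exists_inj_ses (R := R) B
    obtain ⟨j, rfl⟩ : ∃ j, i = j + 1 := ⟨i - 1, by omega⟩
    have h1 := ih B' (fun M _ _ _ i hi => by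
      obtain ⟨j, rfl⟩ : ∃ j, i = j + 1 := ⟨i - 1, by omega⟩
      simpa using hs.cov_right (kil_of_injective hI j 1) (h M (j+1+1) (by omega)))
    simpa using hs.cov_left (h1 M j (by omega)) (kil_of_injective hI j 1)

variable {G : Type u} [AddCommGroup G] [Module R G] (W : GorensteinInjData R G)

attribute [instance] GorensteinInjData.acg GorensteinInjData.mod

/-- projection onto the kernel -/
def gpi (k : ℤ) : W.E (k + 1 + 1) →ₗ[R] LinearMap.ker (W.d k) :=
  (W.d (k+1)).codRestrict _ (fun x => by rw [← W.exact]; exact ⟨x, rfl⟩)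

lemma gses (k : ℤ) : SES (LinearMap.ker (W.d (k+1))).subtype (gpi W k) where
  inj := Subtype.val_injective
  exact := by
    intro x
    rw [Subtype.ext_iff]
    change W.d (k+1) x = 0 ↔ _
    simp
  surj := by
    rintro ⟨x, hx⟩
    rw [← W.exact] at hx
    obtain ⟨y, rfl⟩ := hx
    exact ⟨y, rfl⟩

lemma g_inj {E' : Type u} [AddCommGroup E'] [Module R E'] (hE : Module.Injective R E') (j : ℕ) :
    ∀ k : ℤ, Kil (1:R) (j+1) E' (LinearMap.ker (W.d k)) := by
  induction j with
  | zero =>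
    intro k
    obtain ⟨k, rfl⟩ : ∃ l, k = l + 1 := ⟨k - 1, by ring⟩
    refine ((gses W k).kil_one_iff_cov (kil_of_injective (W.inj _) _ _)).2 ?_
    intro φ
    obtain ⟨ψ, hψ⟩ := (W.homExact E' hE k ((LinearMap.ker (W.d k)).subtype.comp φ)).1 (by
      ext x; exact (φ x).2)
    refine ⟨ψ, ?_⟩
    rw [one_smul]
    exact LinearMap.ext fun x => Subtype.ext (LinearMap.congr_fun hψ x)
  | succ j ih =>
    intro k
    obtain ⟨k, rfl⟩ : ∃ l, k = l + 1 := ⟨k - 1, by ring⟩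
    exact ((gses W k).cov_shift (kil_of_injective (W.inj _) _ _)
      (kil_of_injective (W.inj _) _ _)).2 (ih k)

lemma g_id (n : ℕ) : ∀ (B : Type u) [AddCommGroup B] [Module R B], IdLe R n B →
    ∀ (j : ℕ) (k : ℤ), Kil (1:R) (j+1) B (LinearMap.ker (W.d k)) := by
  induction n with
  | zero =>
    intro B _ _ h j k
    exact g_inj W (injective_of_kil (fun M _ _ => h M 1 (by omega))) j k
  | succ n ih =>
    intro B _ _ h j k
    obtain ⟨I, _, _, B', _, _, f, g, hI, hs⟩ := exists_inj_ses (R := R) B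
    simpa using hs.contra_left (g_inj W hI j k) (ih B' (hs.idLe hI h) (j+1) k)

lemma g_homD {n : ℕ} (hD : IdLe R n D) (k : ℤ) :
    SES ((LinearMap.ker (W.d (k+1))).subtype.compRight R (M := D))
      ((gpi W k).compRight R (M := D)) :=
  (gses W k).homD (W.inj _) (g_id W n D hD 0 (k+1))

variable [IsNoetherianRing R]

lemma hom_inj_kil [Module.Finite R D] (hDD : ∀ i, 0 < i → Kil (1:R) i D D)
    {E : Type u} [AddCommGroup E] [Module R E]
    (hE : Module.Injective R E) (hJ : Module.Injective R J) (j : ℕ) :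
    Kil (1:R) (j+1) (D →ₗ[R] E) (D →ₗ[R] J) := kil_hom' hE hJ (hDD (j+1) (by omega))

lemma g_one [Module.Finite R D] (hDD : ∀ i, 0 < i → Kil (1:R) i D D)
    (hhom : Function.Bijective (fun r : R => (r • (LinearMap.id : D →ₗ[R] D))))
    {n : ℕ} (hD : IdLe R n D) (hJ : Module.Injective R J) (k : ℤ) :
    Kil (1:R) 1 (D →ₗ[R] LinearMap.ker (W.d k)) (D →ₗ[R] J) := by
  have h0 := g_homD W hD k
  have h1 := g_homD W hD (k+1)
  have h2 := gses W (k+1+1)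
  rw [h0.kil_one_iff_contra (hom_inj_kil hDD (W.inj _) hJ 0)]
  intro φ
  obtain ⟨ψ', hψ'⟩ := exists_of_hom (W.inj _) hhom (φ.comp ((gpi W (k+1)).compRight R (M := D)))
  have hz : (ψ'.comp (LinearMap.ker (W.d (k+1+1))).subtype).comp (gpi W (k+1+1)) = 0 := by
    ext w
    obtain ⟨z, rfl⟩ := (evMap_bij (W.inj _) hhom).2 w
    induction z with
    | zero => simp
    | add a b ha hb => rw [map_add, map_add, ha, hb]; simp
    | tmul d h =>
      have e1 := hψ' ((LinearMap.ker (W.d (k+1+1))).subtype.comp ((gpi W (k+1+1)).comp h))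
      have e2 : (gpi W (k+1)).compRight R (M := D)
        ((LinearMap.ker (W.d (k+1+1))).subtype.comp ((gpi W (k+1+1)).comp h)) = 0 :=
        h1.exact.apply_apply_eq_zero ((gpi W (k+1+1)).comp h)
      rw [LinearMap.comp_apply, e2, map_zero] at e1
      exact (LinearMap.congr_fun e1 d).symm
  obtain ⟨ψ1, hψ1⟩ := inj_ext_ex hJ _ _ (gses W (k+1)).exact ψ' (by
    ext z
    obtain ⟨w, rfl⟩ := h2.surj z
    exact LinearMap.congr_fun hz w)
  obtain ⟨ψ2, hψ2⟩ := inj_ext hJ _ (gses W k).inj ψ1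
  refine ⟨ψ2.compRight R, ?_⟩
  rw [one_smul]
  ext n' d
  obtain ⟨h', rfl⟩ := h1.surj n'
  have e1 := LinearMap.congr_fun (hψ' h') d
  have e2 := LinearMap.congr_fun hψ1 (h' d)
  have e3 := LinearMap.congr_fun hψ2 (gpi W (k+1) (h' d))
  exact e3.trans (e2.trans e1.symm)

lemma g_all [Module.Finite R D] (hDD : ∀ i, 0 < i → Kil (1:R) i D D)
    (hhom : Function.Bijective (fun r : R => (r • (LinearMap.id : D →ₗ[R] D))))
    {n : ℕ} (hD : IdLe R n D) (hJ : Module.Injective R J) (j : ℕ) : ∀ (k : ℤ),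
    Kil (1:R) (j+1) (D →ₗ[R] LinearMap.ker (W.d k)) (D →ₗ[R] J) := by
  induction j with
  | zero => exact g_one W hDD hhom hD hJ
  | succ j ih =>
    intro k
    exact ((g_homD W hD k).contra_shift (hom_inj_kil hDD (W.inj _) hJ _)
      (hom_inj_kil hDD (W.inj _) hJ _)).2 (ih (k+1))

lemma g_bound [Module.Finite R D] (hDD : ∀ i, 0 < i → Kil (1:R) i D D)
    (hhom : Function.Bijective (fun r : R => (r • (LinearMap.id : D →ₗ[R] D))))
    {n : ℕ} (hD : IdLe R n D) (m : ℕ) : ∀ (B : Type u) [AddCommGroup B] [Module R B],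
    (∀ i, 0 < i → Kil (1:R) i D B) → IdLe R m B → ∀ (k : ℤ) (i : ℕ), m < i →
    Kil (1:R) i (D →ₗ[R] LinearMap.ker (W.d k)) (D →ₗ[R] B) := by
  induction m with
  | zero =>
    intro B _ _ _ h k i hi
    obtain ⟨j, rfl⟩ : ∃ j, i = j + 1 := ⟨i - 1, by omega⟩
    exact g_all W hDD hhom hD (injective_of_kil (fun M _ _ => h M 1 (by omega))) j k
  | succ m ih =>
    intro B _ _ hDB h k i hi
    obtain ⟨I, _, _, B', _, _, f, g, hI, hs⟩ := exists_inj_ses (R := R) B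
    obtain ⟨j, rfl⟩ : ∃ j, i = j + 1 := ⟨i - 1, by omega⟩
    have h1 := ih B' (fun i hi => by
      obtain ⟨j, rfl⟩ : ∃ j, i = j + 1 := ⟨i - 1, by omega⟩
      simpa using hs.cov_right (kil_of_injective hI j 1) (hDB (j+1+1) (by omega)))
      (hs.idLe hI h) k j (by omega)
    simpa using (hs.homD hI (hDB 1 (by omega))).cov_left h1 (g_all W hDD hhom hD hI j k)

/-- `Hom(D, Hom(Hom(D,E),J)) = Hom(E,J)`. -/
noncomputable def bidualEquiv [Module.Finite R D] {E : Type u} [AddCommGroup E] [Module R E]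
    (hE : Module.Injective R E)
    (hhom : Function.Bijective (fun r : R => (r • (LinearMap.id : D →ₗ[R] D)))) :
    (D →ₗ[R] ((D →ₗ[R] E) →ₗ[R] J)) ≃ₗ[R] (E →ₗ[R] J) :=
  (TensorProduct.lift.equiv (RingHom.id R) D (D →ₗ[R] E) J).trans
    (LinearEquiv.congrLeft J R (LinearEquiv.ofBijective _ (evMap_bij (E := E) hE hhom)))

lemma g_bound_Ep [Module.Finite R D] (hDD : ∀ i, 0 < i → Kil (1:R) i D D)
    (hhom : Function.Bijective (fun r : R => (r • (LinearMap.id : D →ₗ[R] D))))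
    {n : ℕ} (hD : IdLe R n D) {E : Type u} [AddCommGroup E] [Module R E]
    (hE : Module.Injective R E) (hJ : Module.Injective R J) (k : ℤ) (i : ℕ) (hi : n < i) :
    Kil (1:R) i (D →ₗ[R] LinearMap.ker (W.d k)) (E →ₗ[R] J) := by
  refine Kil.congr_right ?_ (bidualEquiv (D := D) hE hhom)
  refine g_bound W hDD hhom hD n _ (fun i hi => kil_hom hE hJ (hDD i hi)) ?_ k i hi
  exact idLe_of_fg n _ (fun M _ _ _ i hi => kil_hom hE hJ (hD M i hi))

lemma g_final [Module.Finite R D] (hDD : ∀ i, 0 < i → Kil (1:R) i D D)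
    (hhom : Function.Bijective (fun r : R => (r • (LinearMap.id : D →ₗ[R] D))))
    {n : ℕ} (hD : IdLe R n D) {E : Type u} [AddCommGroup E] [Module R E]
    (hE : Module.Injective R E) (hJ : Module.Injective R J) (h : ℕ)
    (hH : ∀ i, i ≠ h → ∀ k, Kil (1:R) i (D →ₗ[R] W.E k) (E →ₗ[R] J)) (i : ℕ) (hi : i ≠ h) :
    ∀ k, Kil (1:R) i (D →ₗ[R] LinearMap.ker (W.d k)) (E →ₗ[R] J) := by
  rcases lt_or_gt_of_ne hi with hlt | hgt
  · induction i with
    | zero =>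
      intro k
      have h0 := hH 0 hi (k+1+1)
      rw [kil_zero_iff] at h0 ⊢
      intro f
      rw [one_smul]
      ext1 x
      obtain ⟨y, rfl⟩ := (g_homD W hD k).surj x
      have := LinearMap.congr_fun (h0 (f.comp ((gpi W k).compRight R (M := D)))) y
      rw [one_smul] at this
      exact this
    | succ i ih =>
      intro k
      simpa using (g_homD W hD k).contra_right (ih (by omega) (by omega) (k+1))
        (hH (i+1) hi (k+1+1))
  · have key : ∀ m i, h < i → n < i + m → ∀ k,
        Kil (1:R) i (D →ₗ[R] LinearMap.ker (W.d k)) (E →ₗ[R] J) := by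
      intro m
      induction m with
      | zero => intro i hi hn k; exact g_bound_Ep W hDD hhom hD hE hJ k i (by omega)
      | succ m ih =>
        intro i hi hn k
        obtain ⟨k, rfl⟩ : ∃ l, k = l + 1 := ⟨k - 1, by ring⟩
        simpa using (g_homD W hD k).contra_left (hH i (by omega) (k+1+1))
          (ih (i+1) (by omega) (by omega) k)
    exact key (n+1) i hgt (by omega)

end PartG

theorem tor_injectiveHull_hom_dualizing_gorensteinInjective_isZero
    {R : Type u} [CommRing R] [IsNoetherianRing R]
    (D : Type u) [AddCommGroup D] [Module R D] (hD : IsDualizingModule R D)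
    (p : Ideal R) [hp : p.IsPrime] (h : ℕ) (hph : idealHeight p hp = (h : ℕ∞))
    (Ep : Type u) [AddCommGroup Ep] [Module R Ep]
    (hEp : IsInjectiveHull R (R ⧸ p) Ep)
    (G : Type u) [AddCommGroup G] [Module R G] (hG : IsGorensteinInjective R G) :
    ∀ i : ℕ, i ≠ h →
      Limits.IsZero (((Tor (ModuleCat.{u} R) i).obj (ModuleCat.of R Ep)).obj
        (ModuleCat.of R (D →ₗ[R] G))) := by
  intro i hi
  obtain ⟨hfin, ⟨n, hn⟩, hhom, hDD⟩ := hD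
  obtain ⟨hinj, f, hf, hess⟩ := hEp
  obtain ⟨W⟩ := hG
  have hId : IdLe R n D := by
    intro M _ _ i hi e
    rw [ext_vanish_of_old M D i (by omega) (hn M inferInstance inferInstance i hi) e, smul_zero]
  have hDD' : ∀ i, 0 < i → Kil (1:R) i D D := by
    intro i hi e
    rw [ext_vanish_of_old D D i hi (hDD i hi) e, smul_zero]
  have hJ : Module.Injective R (CharacterModule R) := charModule_inj
  obtain ⟨hass, hreg, hdiv⟩ := hull_facts p hinj f hf hess
  have hH : ∀ i, i ≠ h → ∀ k, Kil (1:R) i (D →ₗ[R] W.E k) (Ep →ₗ[R] CharacterModule R) := by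
    intro i hi k
    refine kil_colim hJ charModule_sep p hreg hdiv i _ ?_
    intro X hX
    have hV : VV D p i (R ⧸ p) :=
      VV_ne p hhom.1 h hph n (fun i hi => hId _ i hi) hDD' i hi
    obtain ⟨s, hs, hk⟩ := VV_sub_hull p hass i hV X hX
    have : Module.Finite R X := Module.Finite.iff_fg.2 hX
    exact ⟨s, hs, kil_hom' (W.inj k) hJ hk⟩
  have hfinal := g_final W hDD' hhom hId hinj hJ h hH i hi (-1)
  have hfinal' : Kil (1:R) i (D →ₗ[R] G) (Ep →ₗ[R] CharacterModule R) :=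
    hfinal.congr_left (LinearEquiv.congrRight W.equiv.symm)
  refine tor_vanish_of_ext charModule_sep Ep (D →ₗ[R] G) i ?_
  intro e
  have := hfinal' e
  rwa [one_smul] at this
end
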